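/- Let 1 < a ≤ b ≤ c ≤ ab and let (H,z), with H = (H_A,H_B,H_C) traceless, be a non-trivial facet normal of C(a,b,c). Then the number of triples (i,j,k) with H_{A,i} + H_{B,j} + H_{C,k} + z < 0 equals #{(i,i') : i < i', H_{A,i} > H_{A,i'}} + #{(j,j') : j < j', H_{B,j} > H_{B,j'}} + #{(k,k') : k < k', H_{C,k} > H_{C,k'}}. -/

import Mathlib

open scoped BigOperators

noncomputable section

/-- The reduced density matrix on the first subsystem. -/
def rhoA {a b c : ℕ} (ψ : Fin a × Fin b × Fin c → ℂ) : Matrix (Fin a) (Fin a) ℂ :=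
  Matrix.of fun i i' => ∑ j : Fin b, ∑ k : Fin c, ψ (i, j, k) * (starRingEnd ℂ) (ψ (i', j, k))

/-- The reduced density matrix on the second subsystem. -/
def rhoB {a b c : ℕ} (ψ : Fin a × Fin b × Fin c → ℂ) : Matrix (Fin b) (Fin b) ℂ :=
  Matrix.of fun j j' => ∑ i : Fin a, ∑ k : Fin c, ψ (i, j, k) * (starRingEnd ℂ) (ψ (i, j', k))

/-- The reduced density matrix on the third subsystem. -/
def rhoC {a b c : ℕ} (ψ : Fin a × Fin b × Fin c → ℂ) : Matrix (Fin c) (Fin c) ℂ :=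
  Matrix.of fun k k' => ∑ i : Fin a, ∑ j : Fin b, ψ (i, j, k) * (starRingEnd ℂ) (ψ (i, j, k'))

/-- `lam` is the vector of eigenvalues of `ρ`, listed in nonincreasing order
with multiplicity. -/
def IsSpecDown {n : ℕ} (ρ : Matrix (Fin n) (Fin n) ℂ) (lam : Fin n → ℝ) : Prop :=
  Antitone lam ∧ ∃ (hρ : ρ.IsHermitian) (σ : Equiv.Perm (Fin n)), lam = hρ.eigenvalues ∘ σ

/-- The Kronecker cone `C(a,b,c)`. -/
def KronCone (a b c : ℕ) : Set ((Fin a → ℝ) × (Fin b → ℝ) × (Fin c → ℝ)) :=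
  { lam | ∃ ψ : Fin a × Fin b × Fin c → ℂ,
      IsSpecDown (rhoA ψ) lam.1 ∧ IsSpecDown (rhoB ψ) lam.2.1 ∧ IsSpecDown (rhoC ψ) lam.2.2 }

/-- The pairing `⟨(H,z), λ⟩`. -/
def wtPair {a b c : ℕ} (HA : Fin a → ℝ) (HB : Fin b → ℝ) (HC : Fin c → ℝ) (z : ℝ)
    (lam : (Fin a → ℝ) × (Fin b → ℝ) × (Fin c → ℝ)) : ℝ :=
  (∑ i, HA i * lam.1 i) + (∑ j, HB j * lam.2.1 j) + (∑ k, HC k * lam.2.2 k)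
    + z * ∑ i, lam.1 i

/-- `H = (H_A, H_B, H_C)` is traceless. -/
def Traceless {a b c : ℕ} (HA : Fin a → ℝ) (HB : Fin b → ℝ) (HC : Fin c → ℝ) : Prop :=
  (∑ i, HA i) = 0 ∧ (∑ j, HB j) = 0 ∧ (∑ k, HC k) = 0

/-- `(H, z)` is a facet normal of the Kronecker cone `C(a,b,c)`. -/
def IsFacetNormal (a b c : ℕ) (HA : Fin a → ℝ) (HB : Fin b → ℝ) (HC : Fin c → ℝ)
    (z : ℝ) : Prop :=
  Traceless HA HB HC ∧ ¬(HA = 0 ∧ HB = 0 ∧ HC = 0 ∧ z = 0) ∧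
  (∀ lam ∈ KronCone a b c, 0 ≤ wtPair HA HB HC z lam) ∧
  Module.finrank ℝ
    (affineSpan ℝ {lam ∈ KronCone a b c | wtPair HA HB HC z lam = 0}).direction
    = a + b + c - 3

/-- `(H, z)` is a trivial (Weyl chamber) normal. -/
def IsTrivialNormal {a b c : ℕ} (HA : Fin a → ℝ) (HB : Fin b → ℝ) (HC : Fin c → ℝ)
    (z : ℝ) : Prop :=
  ∃ t : ℝ, 0 < t ∧
    ((∃ i i' : Fin a, i < i' ∧ HA = t • (Pi.single i 1 - Pi.single i' 1) ∧
        HB = 0 ∧ HC = 0 ∧ z = 0) ∨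
     (∃ j j' : Fin b, j < j' ∧ HB = t • (Pi.single j 1 - Pi.single j' 1) ∧
        HA = 0 ∧ HC = 0 ∧ z = 0) ∨
     (∃ k k' : Fin c, k < k' ∧ HC = t • (Pi.single k 1 - Pi.single k' 1) ∧
        HA = 0 ∧ HB = 0 ∧ z = 0))

/-- The subspace of vectors supported on coordinates satisfying `P`. -/
def suppSubmodule {ι : Type*} (P : ι → Prop) : Submodule ℂ (ι → ℂ) where
  carrier := {ψ | ∀ p, ¬ P p → ψ p = 0}
  add_mem' := by
    intro x y hx hy p hp
    simp only [Pi.add_apply, hx p hp, hy p hp, add_zero]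
  zero_mem' := by intro p _; rfl
  smul_mem' := by
    intro r x hx p hp
    simp only [Pi.smul_apply, hx p hp, smul_zero]

/-- The zero-weight space `ℋ₀(H,z)`. -/
def weight0Space {a b c : ℕ} (HA : Fin a → ℝ) (HB : Fin b → ℝ) (HC : Fin c → ℝ)
    (z : ℝ) : Submodule ℂ (Fin a × Fin b × Fin c → ℂ) :=
  suppSubmodule fun p => HA p.1 + HB p.2.1 + HC p.2.2 + z = 0

/-- The negative-weight space `ℋ₋(H,z)`. -/
def weightNegSpace {a b c : ℕ} (HA : Fin a → ℝ) (HB : Fin b → ℝ) (HC : Fin c → ℝ)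
    (z : ℝ) : Submodule ℂ (Fin a × Fin b × Fin c → ℂ) :=
  suppSubmodule fun p => HA p.1 + HB p.2.1 + HC p.2.2 + z < 0

/-- Strictly lower triangular matrices `X` with `X i' i = 0` unless
`i < i'` and `Hv i' < Hv i`. -/
def lowerMod {d : ℕ} (Hv : Fin d → ℝ) : Submodule ℂ (Matrix (Fin d) (Fin d) ℂ) where
  carrier := {X | ∀ i' i, ¬ (i < i' ∧ Hv i' < Hv i) → X i' i = 0}
  add_mem' := by
    intro X Y hX hY i' i h
    simp only [Matrix.add_apply, hX i' i h, hY i' i h, add_zero]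
  zero_mem' := by intro i' i h; rfl
  smul_mem' := by
    intro r X hX i' i h
    simp only [Matrix.smul_apply, hX i' i h, smul_zero]

/-- The nilpotent algebra `𝔫₋(H)`. -/
def nMinusMod {a b c : ℕ} (HA : Fin a → ℝ) (HB : Fin b → ℝ) (HC : Fin c → ℝ) :
    Submodule ℂ (Matrix (Fin a) (Fin a) ℂ × Matrix (Fin b) (Fin b) ℂ ×
      Matrix (Fin c) (Fin c) ℂ) :=
  (lowerMod HA).prod ((lowerMod HB).prod (lowerMod HC))

/-- The infinitesimal action `(X,Y,Z) ↦ (X⊗I⊗I + I⊗Y⊗I + I⊗I⊗Z)ψ`. -/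
def act {a b c : ℕ}
    (t : Matrix (Fin a) (Fin a) ℂ × Matrix (Fin b) (Fin b) ℂ × Matrix (Fin c) (Fin c) ℂ)
    (ψ : Fin a × Fin b × Fin c → ℂ) : Fin a × Fin b × Fin c → ℂ := fun p =>
  (∑ i', t.1 p.1 i' * ψ (i', p.2.1, p.2.2)) +
  (∑ j', t.2.1 p.2.1 j' * ψ (p.1, j', p.2.2)) +
  (∑ k', t.2.2 p.2.2 k' * ψ (p.1, p.2.1, k'))

/-- The action as a linear map in `(X,Y,Z)`. -/
def actL {a b c : ℕ} (ψ : Fin a × Fin b × Fin c → ℂ) :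
    (Matrix (Fin a) (Fin a) ℂ × Matrix (Fin b) (Fin b) ℂ × Matrix (Fin c) (Fin c) ℂ)
      →ₗ[ℂ] (Fin a × Fin b × Fin c → ℂ) where
  toFun t := act t ψ
  map_add' t s := by
    funext p
    simp only [act, Prod.fst_add, Prod.snd_add, Matrix.add_apply, add_mul,
      Finset.sum_add_distrib, Pi.add_apply]
    ring
  map_smul' r t := by
    funext p
    simp only [act, Prod.smul_fst, Prod.smul_snd, Matrix.smul_apply, smul_eq_mul,
      Pi.smul_apply, RingHom.id_apply, Finset.mul_sum, mul_assoc, mul_add]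

/-- The tangent map `T_ψ : 𝔫₋(H) → ℋ₋(H,z)` is a linear isomorphism. -/
def TangentIso {a b c : ℕ} (HA : Fin a → ℝ) (HB : Fin b → ℝ) (HC : Fin c → ℝ)
    (z : ℝ) (ψ : Fin a × Fin b × Fin c → ℂ) : Prop :=
  ∃ h : ∀ t ∈ nMinusMod HA HB HC, actL ψ t ∈ weightNegSpace HA HB HC z,
    Function.Bijective ((actL ψ).restrict h)

/-- The tangent map `T_ψ : 𝔫₋(H) → ℋ₋(H,z)` is surjective. -/
def TangentSurj {a b c : ℕ} (HA : Fin a → ℝ) (HB : Fin b → ℝ) (HC : Fin c → ℝ)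
    (z : ℝ) (ψ : Fin a × Fin b × Fin c → ℂ) : Prop :=
  ∃ h : ∀ t ∈ nMinusMod HA HB HC, actL ψ t ∈ weightNegSpace HA HB HC z,
    Function.Surjective ((actL ψ).restrict h)

/-- `(H,z)` is admissible: the hyperplane `⟨(H,z), ·⟩ = 0` in `V` is spanned by
the weights of zero `(H,z)`-weight. -/
def Admissible {a b c : ℕ} (HA : Fin a → ℝ) (HB : Fin b → ℝ) (HC : Fin c → ℝ)
    (z : ℝ) : Prop :=
  (Submodule.span ℝ
    { w : (Fin a → ℝ) × (Fin b → ℝ) × (Fin c → ℝ) |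
      ∃ i j k, HA i + HB j + HC k + z = 0 ∧
        w = (Pi.single i 1, Pi.single j 1, Pi.single k 1) } : Set _)
  = { lam | (∑ i, lam.1 i) = (∑ j, lam.2.1 j) ∧ (∑ i, lam.1 i) = (∑ k, lam.2.2 k) ∧
        wtPair HA HB HC z lam = 0 }

/-- `(H,z)` is a Ressayre element. -/
def IsRessayre {a b c : ℕ} (HA : Fin a → ℝ) (HB : Fin b → ℝ) (HC : Fin c → ℝ)
    (z : ℝ) : Prop :=
  Traceless HA HB HC ∧ ¬(HA = 0 ∧ HB = 0 ∧ HC = 0 ∧ z = 0) ∧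
  Admissible HA HB HC z ∧
  ∃ ψ ∈ weight0Space HA HB HC z, TangentIso HA HB HC z ψ

/-- `(H_A, H_B)` satisfies the extremal-edge condition. -/
def ExtremalEdge {a b : ℕ} (HA : Fin a → ℝ) (HB : Fin b → ℝ) : Prop :=
  (∑ i, HA i) = 0 ∧ (∑ j, HB j) = 0 ∧ ¬(HA = 0 ∧ HB = 0) ∧
  ∀ (x : Fin a → ℝ) (y : Fin b → ℝ), (∑ i, x i) = 0 → (∑ j, y j) = 0 →
    (∀ i j k l, HA i + HB j = HA k + HB l → x i + y j = x k + y l) →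
    ∃ t : ℝ, x = t • HA ∧ y = t • HB

set_option linter.unusedSectionVars false

namespace Multipartite

section

open Matrix Function

variable {S : Type*} [Fintype S] [DecidableEq S] {d : S → ℕ}

/-- The partial trace of `|φ⟩⟨ψ|` over all legs except `s`. -/
def marg (s : S) (φ ψ : (∀ s, Fin (d s)) → ℂ) : Matrix (Fin (d s)) (Fin (d s)) ℂ :=
  Matrix.of fun i j => ∑ p, if p s = i then φ p * star (ψ (update p s j)) else 0

/-- The matrix `X` acting on the leg `s`. -/
def legOp (s : S) (X : Matrix (Fin (d s)) (Fin (d s)) ℂ) (ψ : (∀ s, Fin (d s)) → ℂ) :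
    (∀ s, Fin (d s)) → ℂ :=
  fun p => ∑ j, X (p s) j * ψ (update p s j)

lemma sum_update_swap {M : Type*} [AddCommMonoid M] (s : S)
    (f : (∀ s, Fin (d s)) → (∀ s, Fin (d s)) → M) :
    ∑ p, ∑ i, f p (update p s i) = ∑ p, ∑ i, f (update p s i) p := by
  rw [← Fintype.sum_prod_type' (fun p i => f p (update p s i)),
    ← Fintype.sum_prod_type' (fun p i => f (update p s i) p)]
  refine Fintype.sum_bijective (fun x : (∀ s, Fin (d s)) × Fin (d s) => (update x.1 s x.2, x.1 s))
    (Involutive.bijective fun x => ?_) _ _ fun x => ?_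
  · simp
  · simp

lemma sum_ite_leg {M : Type*} [AddCommMonoid M] (s : S) (f : (∀ s, Fin (d s)) → Fin (d s) → M) :
    ∑ i, ∑ p, (if p s = i then f p i else 0) = ∑ p, f p (p s) := by
  rw [Finset.sum_comm]
  simp

lemma marg_eq_sum (s : S) (φ ψ : (∀ s, Fin (d s)) → ℂ) (i j : Fin (d s)) :
    marg s φ ψ i j = ∑ p, if p s = j then φ (update p s i) * star (ψ p) else 0 := by
  have h := sum_update_swap (d := d) s
    (fun p q => if p s = i ∧ q s = j then φ p * star (ψ q) else 0)
  have e1 : ∀ p : ∀ s, Fin (d s), (∑ k, if p s = i ∧ (update p s k) s = j then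
      φ p * star (ψ (update p s k)) else 0)
      = if p s = i then φ p * star (ψ (update p s j)) else 0 := by
    intro p
    by_cases hp : p s = i <;> simp [hp]
  have e2 : ∀ p : ∀ s, Fin (d s), (∑ k, if (update p s k) s = i ∧ p s = j then
      φ (update p s k) * star (ψ p) else 0)
      = if p s = j then φ (update p s i) * star (ψ p) else 0 := by
    intro p
    by_cases hp : p s = j <;> simp [hp]
  simp only [e1, e2] at h
  simpa [marg] using h

lemma conjTranspose_marg (s : S) (φ ψ : (∀ s, Fin (d s)) → ℂ) :
    (marg s φ ψ)ᴴ = marg s ψ φ := by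
  ext i j
  rw [conjTranspose_apply, marg_eq_sum s φ ψ]
  simp only [marg, of_apply, star_sum]
  refine Finset.sum_congr rfl fun p _ => ?_
  split_ifs <;> simp [mul_comm]

lemma marg_self_isHermitian (s : S) (ψ : (∀ s, Fin (d s)) → ℂ) :
    (marg s ψ ψ).IsHermitian := conjTranspose_marg s ψ ψ

lemma marg_add_left (s : S) (φ φ' ψ : (∀ s, Fin (d s)) → ℂ) :
    marg s (φ + φ') ψ = marg s φ ψ + marg s φ' ψ := by
  ext i j
  simp only [marg, of_apply, Matrix.add_apply, ← Finset.sum_add_distrib]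
  refine Finset.sum_congr rfl fun p _ => ?_
  split_ifs <;> simp [add_mul]

lemma marg_smul_left (s : S) (t : ℂ) (φ ψ : (∀ s, Fin (d s)) → ℂ) :
    marg s (t • φ) ψ = t • marg s φ ψ := by
  ext i j
  simp only [marg, of_apply, Matrix.smul_apply, Finset.smul_sum]
  refine Finset.sum_congr rfl fun p _ => ?_
  split_ifs <;> simp [mul_assoc]

lemma marg_add_right (s : S) (φ ψ ψ' : (∀ s, Fin (d s)) → ℂ) :
    marg s φ (ψ + ψ') = marg s φ ψ + marg s φ ψ' := by
  rw [← conjTranspose_marg, marg_add_left, conjTranspose_add, conjTranspose_marg,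
    conjTranspose_marg]

lemma marg_smul_right (s : S) (t : ℂ) (φ ψ : (∀ s, Fin (d s)) → ℂ) :
    marg s φ (t • ψ) = star t • marg s φ ψ := by
  rw [← conjTranspose_marg, marg_smul_left, conjTranspose_smul, conjTranspose_marg]

lemma dotProduct_legOp (s : S) (X : Matrix (Fin (d s)) (Fin (d s)) ℂ)
    (φ ψ : (∀ s, Fin (d s)) → ℂ) :
    star φ ⬝ᵥ legOp s X ψ = trace (X * marg s ψ φ) := by
  have h := sum_update_swap (d := d) s (fun p q => star (φ p) * (X (p s) (q s) * ψ q))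
  simp only [update_self] at h
  simp only [dotProduct, legOp, Finset.mul_sum, Pi.star_apply]
  rw [h]
  simp only [trace, Matrix.diag_apply, mul_apply, marg, of_apply, Finset.mul_sum, mul_ite, mul_zero]
  rw [Finset.sum_comm]
  refine Finset.sum_congr rfl fun i _ => ?_
  rw [sum_ite_leg s (fun p j => X i j * (ψ p * star (φ (update p s i))))]
  refine Finset.sum_congr rfl fun p _ => ?_
  ring

lemma legOp_legOp (s : S) (X Y : Matrix (Fin (d s)) (Fin (d s)) ℂ)
    (ψ : (∀ s, Fin (d s)) → ℂ) : legOp s X (legOp s Y ψ) = legOp s (X * Y) ψ := by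
  funext p
  simp only [legOp, update_self, update_idem, mul_apply, Finset.mul_sum, Finset.sum_mul]
  rw [Finset.sum_comm]
  simp only [mul_assoc]

lemma legOp_comm {s t : S} (hst : s ≠ t) (X : Matrix (Fin (d s)) (Fin (d s)) ℂ)
    (Y : Matrix (Fin (d t)) (Fin (d t)) ℂ) (ψ : (∀ s, Fin (d s)) → ℂ) :
    legOp s X (legOp t Y ψ) = legOp t Y (legOp s X ψ) := by
  funext p
  simp only [legOp, update_of_ne hst, update_of_ne hst.symm, Finset.mul_sum]
  rw [Finset.sum_comm]
  refine Finset.sum_congr rfl fun i _ => Finset.sum_congr rfl fun j _ => ?_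
  rw [update_comm hst]
  ring

lemma star_legOp_dotProduct (s : S) (X : Matrix (Fin (d s)) (Fin (d s)) ℂ)
    (φ ψ : (∀ s, Fin (d s)) → ℂ) :
    star (legOp s X φ) ⬝ᵥ ψ = star φ ⬝ᵥ legOp s Xᴴ ψ := by
  have h : star (legOp s X φ) ⬝ᵥ ψ = star (star ψ ⬝ᵥ legOp s X φ) := by
    rw [star_dotProduct]
  rw [h, dotProduct_legOp, dotProduct_legOp, ← trace_conjTranspose, conjTranspose_mul,
    conjTranspose_marg, trace_mul_comm]

lemma legOp_one (s : S) (ψ : (∀ s, Fin (d s)) → ℂ) : legOp s 1 ψ = ψ := by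
  funext p
  simp [legOp, one_apply]

lemma marg_legOp_left (s : S) (X : Matrix (Fin (d s)) (Fin (d s)) ℂ)
    (φ ψ : (∀ s, Fin (d s)) → ℂ) : marg s (legOp s X φ) ψ = X * marg s φ ψ := by
  refine ext_iff_trace_mul_left.2 fun Y => ?_
  rw [← dotProduct_legOp, ← Matrix.mul_assoc, ← dotProduct_legOp, legOp_legOp]

lemma marg_legOp_right (s : S) (X : Matrix (Fin (d s)) (Fin (d s)) ℂ)
    (φ ψ : (∀ s, Fin (d s)) → ℂ) : marg s φ (legOp s X ψ) = marg s φ ψ * Xᴴ := by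
  rw [← conjTranspose_marg, marg_legOp_left, conjTranspose_mul, conjTranspose_marg]

lemma marg_legOp_of_ne {s t : S} (hst : s ≠ t) (X : Matrix (Fin (d t)) (Fin (d t)) ℂ)
    (φ ψ : (∀ s, Fin (d s)) → ℂ) : marg s (legOp t X φ) ψ = marg s φ (legOp t Xᴴ ψ) := by
  refine ext_iff_trace_mul_left.2 fun Y => ?_
  rw [← dotProduct_legOp, ← dotProduct_legOp, legOp_comm hst, star_legOp_dotProduct,
    conjTranspose_conjTranspose]

lemma exists_rotate (U : ∀ s, Matrix (Fin (d s)) (Fin (d s)) ℂ) (hU : ∀ s, (U s)ᴴ * U s = 1)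
    (ψ : (∀ s, Fin (d s)) → ℂ) :
    ∃ ψ' : (∀ s, Fin (d s)) → ℂ, ∀ s, marg s ψ' ψ' = U s * marg s ψ ψ * (U s)ᴴ := by
  suffices h : ∀ T : Finset S, ∃ ψ' : (∀ s, Fin (d s)) → ℂ, ∀ s,
      marg s ψ' ψ' = if s ∈ T then U s * marg s ψ ψ * (U s)ᴴ else marg s ψ ψ by
    obtain ⟨ψ', h'⟩ := h Finset.univ
    exact ⟨ψ', fun s => by simpa using h' s⟩
  intro T
  induction T using Finset.induction_on with
  | empty => exact ⟨ψ, by simp⟩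
  | insert t T ht ih =>
    obtain ⟨φ, hφ⟩ := ih
    refine ⟨legOp t (U t) φ, fun s => ?_⟩
    by_cases hst : s = t
    · subst hst
      rw [marg_legOp_left, marg_legOp_right, hφ]
      simp [ht, Matrix.mul_assoc]
    · rw [marg_legOp_of_ne hst, legOp_legOp, hU, legOp_one, hφ]
      simp [hst]

end

section

open Matrix Function Filter Topology

/-- The real diagonal matrix with entries `x`, viewed over `ℂ`. -/
def rdiag {n : ℕ} (x : Fin n → ℝ) : Matrix (Fin n) (Fin n) ℂ := diagonal fun i => (x i : ℂ)

lemma exists_unitary_of_eigenvalues {n : ℕ} {ρ : Matrix (Fin n) (Fin n) ℂ} (hρ : ρ.IsHermitian)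
    (σ : Equiv.Perm (Fin n)) :
    ∃ U : Matrix (Fin n) (Fin n) ℂ, Uᴴ * U = 1 ∧ U * ρ * Uᴴ = rdiag (hρ.eigenvalues ∘ σ) := by
  set V : Matrix (Fin n) (Fin n) ℂ := ↑hρ.eigenvectorUnitary with hV
  have hVV : Vᴴ * V = 1 := Unitary.coe_star_mul_self hρ.eigenvectorUnitary
  have hd : Vᴴ * ρ * V = rdiag hρ.eigenvalues := by
    have h := hρ.conjStarAlgAut_star_eigenvectorUnitary
    simpa [Unitary.conjStarAlgAut_apply, rdiag, Function.comp_def, star_eq_conjTranspose] using h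
  refine ⟨(V.submatrix id σ)ᴴ, ?_, ?_⟩
  · rw [conjTranspose_conjTranspose]
    have h1 : (V.submatrix id σ)ᴴ * V.submatrix id σ = 1 := by
      have : (V.submatrix id σ)ᴴ * V.submatrix id σ = (Vᴴ * V).submatrix σ σ := by
        ext i j
        simp [mul_apply]
      rw [this, hVV, submatrix_one_equiv]
    exact mul_eq_one_comm.1 h1
  · rw [conjTranspose_conjTranspose]
    have : (V.submatrix id σ)ᴴ * ρ * V.submatrix id σ = (Vᴴ * ρ * V).submatrix σ σ := by
      ext i j
      simp [mul_apply]
    rw [this, hd, rdiag, submatrix_diagonal_equiv]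
    rfl

lemma exists_sorted_unitary {n : ℕ} {ρ : Matrix (Fin n) (Fin n) ℂ} (hρ : ρ.IsHermitian) :
    ∃ x : Fin n → ℝ, Antitone x ∧
      ∃ U : Matrix (Fin n) (Fin n) ℂ, Uᴴ * U = 1 ∧ U * ρ * Uᴴ = rdiag x := by
  refine ⟨hρ.eigenvalues ∘ Tuple.sort (fun i => -hρ.eigenvalues i), fun i j hij => ?_,
    exists_unitary_of_eigenvalues hρ _⟩
  have := Tuple.monotone_sort (fun i => -hρ.eigenvalues i) hij
  simpa using this

lemma rigid_of_strictAnti {n : ℕ} {x y : Fin n → ℝ} (hx : StrictAnti x) (hy : Antitone y)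
    {U : Matrix (Fin n) (Fin n) ℂ} (hU : Uᴴ * U = 1) (h : U * rdiag x * Uᴴ = rdiag y) :
    ∀ i j, i ≠ j → U i j = 0 := by
  have hU' : U * Uᴴ = 1 := mul_eq_one_comm.1 hU
  have h1 : U * rdiag x = rdiag y * U := by
    rw [← h, Matrix.mul_assoc, Matrix.mul_assoc, hU, Matrix.mul_one]
  have h2 : ∀ i j, U i j ≠ 0 → x j = y i := by
    intro i j hij
    have := congrFun (congrFun h1 i) j
    rw [rdiag, rdiag, mul_diagonal, diagonal_mul, mul_comm] at this
    exact_mod_cast mul_right_cancel₀ hij this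
  have h3 : ∀ i, ∃ j, U i j ≠ 0 := by
    intro i
    by_contra! hc
    have := congrFun (congrFun hU' i) i
    simp [mul_apply, hc] at this
  choose f hf using h3
  have h4 : ∀ i j, U i j ≠ 0 → j = f i := fun i j hij =>
    hx.injective ((h2 i j hij).trans (h2 i _ (hf i)).symm)
  have h5 : Injective f := by
    intro i i' hii
    by_contra hne
    have := congrFun (congrFun hU' i) i'
    rw [mul_apply, Finset.sum_eq_single (f i)] at this
    · rw [one_apply_ne hne, conjTranspose_apply, mul_eq_zero, star_eq_zero] at this
      rcases this with h | h
      · exact hf i h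
      · rw [hii] at h
        exact hf i' h
    · intro j _ hj
      have : U i j = 0 := by
        by_contra hc
        exact hj (h4 i j hc)
      simp [this]
    · simp
  have h6 : Monotone f := by
    intro i i' hii
    have := hy hii
    rw [← h2 i _ (hf i), ← h2 i' _ (hf i')] at this
    exact hx.le_iff_ge.1 this
  have h7 : f = id := by
    have h8 := (Equiv.Perm.monotone_iff
      (Equiv.ofBijective f (Finite.injective_iff_bijective.1 h5))).1 h6
    exact congrArg (fun σ : Equiv.Perm (Fin n) => (σ : Fin n → Fin n)) h8
  intro i j hij
  by_contra hc
  exact hij (by rw [h4 i j hc, h7, id])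

variable {S : Type*} [Fintype S] [DecidableEq S] {d : S → ℕ}

lemma isCompact_unitaries :
    IsCompact {U : ∀ s, Matrix (Fin (d s)) (Fin (d s)) ℂ | ∀ s, (U s)ᴴ * U s = 1} := by
  have hc : IsCompact (Set.pi Set.univ fun s : S => Set.pi Set.univ fun _ : Fin (d s) =>
      Set.pi Set.univ fun _ : Fin (d s) => Metric.closedBall (0 : ℂ) 1) :=
    isCompact_univ_pi fun s => isCompact_univ_pi fun _ => isCompact_univ_pi fun _ =>
      isCompact_closedBall _ _
  refine hc.of_isClosed_subset ?_ ?_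
  · simp only [Set.ofPred_forall]
    refine isClosed_iInter fun s => ?_
    refine isClosed_eq ?_ continuous_const
    exact ((continuous_apply s).matrix_conjTranspose).matrix_mul (continuous_apply s)
  · intro U hU s _ i _ j _
    rw [mem_closedBall_zero_iff]
    exact entry_norm_bound_of_unitary (mem_unitaryGroup_iff'.2 (hU s)) i j

lemma exists_seq_spec_deriv {lam : ∀ s, Fin (d s) → ℝ} (hlam : ∀ s, StrictAnti (lam s))
    (ρ : ℕ → ∀ s, Matrix (Fin (d s)) (Fin (d s)) ℂ) (hρ : ∀ n s, (ρ n s).IsHermitian)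
    (τ : ℕ → ℝ) (hτ : ∀ n, 0 < τ n) (hτ0 : Tendsto τ atTop (𝓝 0))
    (N : ∀ s, Matrix (Fin (d s)) (Fin (d s)) ℂ)
    (hN : ∀ s, Tendsto (fun n => (τ n : ℂ)⁻¹ • (ρ n s - rdiag (lam s))) atTop (𝓝 (N s))) :
    ∃ (φ : ℕ → ℕ) (μ : ℕ → ∀ s, Fin (d s) → ℝ), StrictMono φ ∧
      (∀ n s, Antitone (μ n s) ∧ ∃ U : Matrix (Fin (d s)) (Fin (d s)) ℂ,
        Uᴴ * U = 1 ∧ U * ρ (φ n) s * Uᴴ = rdiag (μ n s)) ∧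
      ∀ s i, Tendsto (fun n => (μ n s i - lam s i) / τ (φ n)) atTop (𝓝 (N s i i).re) := by
  choose x hx U hU hUx using fun n s => exists_sorted_unitary (hρ n s)
  have : FirstCountableTopology (∀ s, Matrix (Fin (d s)) (Fin (d s)) ℂ) :=
    inferInstanceAs (FirstCountableTopology (∀ s, Fin (d s) → Fin (d s) → ℂ))
  obtain ⟨V, hV, φ, hφ, hlim⟩ := (isCompact_unitaries (d := d)).tendsto_subseq (x := U)
    (fun n => hU n)
  refine ⟨φ, fun n => x (φ n), hφ, fun n s => ⟨hx _ _, _, hU _ _, hUx _ _⟩, fun s i => ?_⟩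
  have hV : (V s)ᴴ * V s = 1 := hV s
  have hVs : Tendsto (fun n => U (φ n) s) atTop (𝓝 (V s)) :=
    (tendsto_pi_nhds.1 hlim) s
  have hN' : Tendsto (fun n => (τ (φ n) : ℂ)⁻¹ • (ρ (φ n) s - rdiag (lam s))) atTop (𝓝 (N s)) :=
    (hN s).comp hφ.tendsto_atTop
  have hτ' : Tendsto (fun n => (τ (φ n) : ℂ)) atTop (𝓝 0) := by
    have := (Complex.continuous_ofReal.tendsto 0).comp (hτ0.comp hφ.tendsto_atTop)
    simpa [Function.comp_def] using this
  have hne : ∀ n, (τ n : ℂ) ≠ 0 := fun n => by exact_mod_cast (hτ n).ne'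
  have hρ' : Tendsto (fun n => ρ (φ n) s) atTop (𝓝 (rdiag (lam s))) := by
    have := (hτ'.smul hN').add_const (rdiag (lam s))
    simpa [smul_smul, hne] using this
  have hlimD : Tendsto (fun n => rdiag (x (φ n) s)) atTop
      (𝓝 (V s * rdiag (lam s) * (V s)ᴴ)) := by
    have hc : Tendsto (fun n => (U (φ n) s)ᴴ) atTop (𝓝 (V s)ᴴ) :=
      (Continuous.matrix_conjTranspose continuous_id).continuousAt.tendsto.comp hVs
    have := (hVs.mul hρ').mul hc
    simpa only [hUx] using this
  have hentry : ∀ j k, Tendsto (fun n => rdiag (x (φ n) s) j k) atTop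
      (𝓝 ((V s * rdiag (lam s) * (V s)ᴴ) j k)) := fun j k =>
    tendsto_pi_nhds.1 (tendsto_pi_nhds.1 hlimD j) k
  have hdiag : V s * rdiag (lam s) * (V s)ᴴ
      = rdiag fun j => ((V s * rdiag (lam s) * (V s)ᴴ) j j).re := by
    ext j k
    by_cases hjk : j = k
    · subst hjk
      have h1 := hentry j j
      have h2 : Tendsto (fun n => rdiag (x (φ n) s) j j) atTop
          (𝓝 ((((V s * rdiag (lam s) * (V s)ᴴ) j j).re : ℝ) : ℂ)) := by
        have := (Complex.continuous_ofReal.tendsto _).comp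
          ((Complex.continuous_re.tendsto _).comp h1)
        simpa [rdiag, Function.comp_def] using this
      rw [tendsto_nhds_unique h1 h2]
      simp [rdiag]
    · have h1 := hentry j k
      simp only [rdiag, diagonal_apply_ne _ hjk] at h1 ⊢
      exact tendsto_nhds_unique h1 tendsto_const_nhds
  have hanti : Antitone fun j => ((V s * rdiag (lam s) * (V s)ᴴ) j j).re := by
    intro j k hjk
    have h1 := (Complex.continuous_re.tendsto _).comp (hentry j j)
    have h2 := (Complex.continuous_re.tendsto _).comp (hentry k k)
    refine le_of_tendsto_of_tendsto' h2 h1 fun n => ?_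
    simpa [rdiag] using hx (φ n) s hjk
  have hoff := rigid_of_strictAnti (hlam s) hanti hV hdiag
  have hVii : V s i i ≠ 0 := by
    intro h0
    have := congrFun (congrFun hV i) i
    rw [mul_apply] at this
    have hz : ∀ k, V s k i = 0 := fun k => by
      by_cases hk : k = i
      · rw [hk, h0]
      · exact hoff k i hk
    simp [hz] at this
  have hUii : Tendsto (fun n => U (φ n) s i i) atTop (𝓝 (V s i i)) :=
    tendsto_pi_nhds.1 (tendsto_pi_nhds.1 hVs i) i
  have hUN : Tendsto (fun n => (U (φ n) s *
      ((τ (φ n) : ℂ)⁻¹ • (ρ (φ n) s - rdiag (lam s)))) i i) atTop (𝓝 ((V s * N s) i i)) :=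
    tendsto_pi_nhds.1 (tendsto_pi_nhds.1 (hVs.mul hN') i) i
  have hVN : (V s * N s) i i / V s i i = N s i i := by
    rw [mul_apply, Finset.sum_eq_single i]
    · field_simp
    · intro j _ hj
      rw [hoff i j hj.symm, zero_mul]
    · simp
  have hquot := hUN.div hUii hVii
  rw [hVN] at hquot
  have hre := (Complex.continuous_re.tendsto _).comp hquot
  refine hre.congr' ?_
  filter_upwards [hUii.eventually_ne hVii] with n hn
  have h1 : U (φ n) s * ρ (φ n) s = rdiag (x (φ n) s) * U (φ n) s := by
    rw [← hUx, Matrix.mul_assoc, Matrix.mul_assoc, hU, Matrix.mul_one]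
  have h2 : (U (φ n) s * ((τ (φ n) : ℂ)⁻¹ • (ρ (φ n) s - rdiag (lam s)))) i i / U (φ n) s i i
      = (((x (φ n) s i - lam s i) / τ (φ n) : ℝ) : ℂ) := by
    rw [Matrix.mul_smul, Matrix.mul_sub, h1, rdiag, rdiag, Matrix.smul_apply, Matrix.sub_apply,
      diagonal_mul, mul_diagonal]
    have := hne (φ n)
    push_cast
    simp only [smul_eq_mul]
    field_simp
  simp only [Function.comp_apply]
  exact (congrArg Complex.re h2).trans (Complex.ofReal_re _)

end

section

open Matrix Function Filter Topology

variable {S : Type*} [Fintype S] [DecidableEq S] {d : S → ℕ}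

/-- The compatible spectra of one-body marginals of (unnormalized) pure states. -/
def cone (d : S → ℕ) : Set (∀ s, Fin (d s) → ℝ) :=
  {lam | (∀ s, Antitone (lam s)) ∧
    ∃ ψ : (∀ s, Fin (d s)) → ℂ, ∀ s, marg s ψ ψ = rdiag (lam s)}

/-- The linear functional on spectra defined by `H`. -/
def pairing (H lam : ∀ s, Fin (d s) → ℝ) : ℝ := ∑ s, ∑ i, H s i * lam s i

/-- The eigenvalue of the Hamiltonian `∑ s, H s` on the basis vector `p`. -/
def weight (H : ∀ s, Fin (d s) → ℝ) (p : ∀ s, Fin (d s)) : ℝ := ∑ s, H s (p s)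

lemma weight_update (H : ∀ s, Fin (d s) → ℝ) (p : ∀ s, Fin (d s)) (s : S) (j : Fin (d s)) :
    weight H (update p s j) = weight H p - H s (p s) + H s j := by
  unfold weight
  rw [← Finset.add_sum_erase _ _ (Finset.mem_univ s),
    ← Finset.add_sum_erase (a := s) _ _ (Finset.mem_univ s), update_self]
  have : ∑ x ∈ Finset.univ.erase s, H x (update p s j x)
      = ∑ x ∈ Finset.univ.erase s, H x (p x) :=
    Finset.sum_congr rfl fun x hx => by rw [update_of_ne (Finset.ne_of_mem_erase hx)]
  rw [this]
  ring

lemma sum_mul_marg_diag (H : ∀ s, Fin (d s) → ℝ) (η φ : (∀ s, Fin (d s)) → ℂ) :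
    ∑ s, ∑ i, (H s i : ℂ) * marg s η φ i i = ∑ p, (weight H p : ℂ) * (η p * star (φ p)) := by
  have h : ∀ s, ∑ i, (H s i : ℂ) * marg s η φ i i
      = ∑ p, (H s (p s) : ℂ) * (η p * star (φ p)) := by
    intro s
    have := sum_ite_leg (d := d) s fun p i => (H s i : ℂ) * (η p * star (φ (update p s i)))
    simp only [update_eq_self] at this
    rw [← this]
    refine Finset.sum_congr rfl fun i _ => ?_
    simp only [marg, of_apply, Finset.mul_sum, mul_ite, mul_zero]
  simp only [h]
  rw [Finset.sum_comm]
  refine Finset.sum_congr rfl fun p _ => ?_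
  rw [← Finset.sum_mul, weight]
  push_cast
  rfl

lemma sum_mul_marg_diag_re (H : ∀ s, Fin (d s) → ℝ) (η φ : (∀ s, Fin (d s)) → ℂ) :
    ∑ s, ∑ i, H s i * (marg s η φ i i).re = ∑ p, weight H p * (η p * star (φ p)).re := by
  have := congrArg Complex.re (sum_mul_marg_diag H η φ)
  simpa only [Complex.re_sum, Complex.re_ofReal_mul] using this

lemma marg_add_smul (s : S) (ψ η : (∀ s, Fin (d s)) → ℂ) (t : ℝ) :
    marg s (ψ + (t : ℂ) • η) (ψ + (t : ℂ) • η) = marg s ψ ψ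
      + (t : ℂ) • (marg s η ψ + marg s ψ η) + ((t : ℂ) * t) • marg s η η := by
  rw [marg_add_left, marg_add_right, marg_add_right, marg_smul_left, marg_smul_left,
    marg_smul_right, marg_smul_right]
  simp only [Complex.star_def, Complex.conj_ofReal, smul_smul, smul_add]
  abel

section Variation

variable {H lam : ∀ s, Fin (d s) → ℝ} (hpos : ∀ μ ∈ cone d, 0 ≤ pairing H μ)
  (hlam : ∀ s, StrictAnti (lam s)) (h0 : pairing H lam = 0)

include hpos hlam h0 in
lemma nonneg_of_tendsto (χ : ℕ → (∀ s, Fin (d s)) → ℂ)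
    (τ : ℕ → ℝ) (hτ : ∀ n, 0 < τ n) (hτ0 : Tendsto τ atTop (𝓝 0))
    (N : ∀ s, Matrix (Fin (d s)) (Fin (d s)) ℂ)
    (hN : ∀ s, Tendsto (fun n => (τ n : ℂ)⁻¹ • (marg s (χ n) (χ n) - rdiag (lam s))) atTop
      (𝓝 (N s))) :
    0 ≤ ∑ s, ∑ i, H s i * (N s i i).re := by
  obtain ⟨φ, μ, -, hμ, hlim⟩ := exists_seq_spec_deriv hlam (fun n s => marg s (χ n) (χ n))
    (fun n s => marg_self_isHermitian s (χ n)) τ hτ hτ0 N hN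
  have hT : Tendsto (fun n => ∑ s, ∑ i, H s i * ((μ n s i - lam s i) / τ (φ n))) atTop
      (𝓝 (∑ s, ∑ i, H s i * (N s i i).re)) :=
    tendsto_finsetSum _ fun s _ => tendsto_finsetSum _ fun i _ => (hlim s i).const_mul _
  refine ge_of_tendsto' hT fun n => ?_
  choose hanti U hU hUm using fun s => hμ n s
  obtain ⟨ψ', hψ'⟩ := exists_rotate U hU (χ (φ n))
  have hp := hpos (μ n) ⟨hanti, ψ', fun s => by rw [hψ', hUm]⟩
  have : ∑ s, ∑ i, H s i * ((μ n s i - lam s i) / τ (φ n))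
      = (pairing H (μ n) - pairing H lam) / τ (φ n) := by
    simp only [pairing, ← Finset.sum_sub_distrib, Finset.sum_div]
    refine Finset.sum_congr rfl fun s _ => Finset.sum_congr rfl fun i _ => ?_
    ring
  rw [this, h0, sub_zero]
  exact div_nonneg hp (hτ _).le

variable {ψ : (∀ s, Fin (d s)) → ℂ} (hψ : ∀ s, marg s ψ ψ = rdiag (lam s))

lemma tendsto_one_div_add_atTop_ofReal :
    Tendsto (fun n : ℕ => ((1 / ((n : ℝ) + 1) : ℝ) : ℂ)) atTop (𝓝 0) := by
  have := (Complex.continuous_ofReal.tendsto 0).comp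
    (tendsto_one_div_add_atTop_nhds_zero_nat (𝕜 := ℝ))
  simpa [Function.comp_def] using this

include hpos hlam h0 hψ in
lemma weight_eq_zero_of_ne_zero (p : ∀ s, Fin (d s)) (hp : ψ p ≠ 0) : weight H p = 0 := by
  set η : (∀ s, Fin (d s)) → ℂ := fun p => -(weight H p : ℂ) * ψ p with hη
  have key := nonneg_of_tendsto hpos hlam h0
    (fun n => ψ + ((1 / ((n : ℝ) + 1) : ℝ) : ℂ) • η) (fun n => 1 / ((n : ℝ) + 1))
    (fun n => by positivity) tendsto_one_div_add_atTop_nhds_zero_nat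
    (fun s => marg s η ψ + marg s ψ η) (fun s => by
      have hl : Tendsto (fun n : ℕ => marg s η ψ + marg s ψ η
          + ((1 / ((n : ℝ) + 1) : ℝ) : ℂ) • marg s η η) atTop
          (𝓝 (marg s η ψ + marg s ψ η)) := by
        have := (tendsto_one_div_add_atTop_ofReal.smul_const (marg s η η)).const_add
          (marg s η ψ + marg s ψ η)
        simpa using this
      refine hl.congr fun n => ?_
      have hne : ((1 / ((n : ℝ) + 1) : ℝ) : ℂ) ≠ 0 := by
        exact_mod_cast (by positivity : (1 / ((n : ℝ) + 1)) ≠ 0)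
      rw [marg_add_smul, hψ, add_assoc (rdiag (lam s)), add_sub_cancel_left, smul_add _ _ ((_ : ℂ) • marg s η η),
        smul_smul, smul_smul, inv_mul_cancel₀ hne, inv_mul_cancel_left₀ hne, one_smul])
  have h1 : ∑ s, ∑ i, H s i * ((marg s η ψ + marg s ψ η) i i).re
      = -∑ p, 2 * (weight H p ^ 2 * Complex.normSq (ψ p)) := by
    simp only [Matrix.add_apply, Complex.add_re, mul_add, Finset.sum_add_distrib]
    rw [sum_mul_marg_diag_re, sum_mul_marg_diag_re, ← Finset.sum_add_distrib,
      ← Finset.sum_neg_distrib]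
    refine Finset.sum_congr rfl fun p _ => ?_
    simp only [hη, Complex.normSq_apply, Complex.star_def, Complex.mul_re, Complex.mul_im,
      Complex.conj_re, Complex.conj_im, Complex.neg_re, Complex.neg_im, Complex.ofReal_re,
      Complex.ofReal_im]
    ring
  rw [h1, Left.nonneg_neg_iff] at key
  have hnn : ∀ p ∈ Finset.univ, 0 ≤ 2 * (weight H p ^ 2 * Complex.normSq (ψ p)) :=
    fun p _ => mul_nonneg zero_le_two (mul_nonneg (sq_nonneg _) (Complex.normSq_nonneg _))
  have h2 := (Finset.sum_eq_zero_iff_of_nonneg hnn).1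
    (le_antisymm key (Finset.sum_nonneg hnn)) p (Finset.mem_univ p)
  simpa [hp] using h2

include hpos hlam h0 hψ in
lemma second_variation (η : (∀ s, Fin (d s)) → ℂ) (hη : ∀ s, marg s η ψ + marg s ψ η = 0) :
    0 ≤ ∑ p, weight H p * Complex.normSq (η p) := by
  have key := nonneg_of_tendsto hpos hlam h0
    (fun n => ψ + ((1 / ((n : ℝ) + 1) : ℝ) : ℂ) • η)
    (fun n => 1 / ((n : ℝ) + 1) * (1 / ((n : ℝ) + 1)))
    (fun n => by positivity) (by
      simpa using (tendsto_one_div_add_atTop_nhds_zero_nat (𝕜 := ℝ)).mul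
        (tendsto_one_div_add_atTop_nhds_zero_nat (𝕜 := ℝ)))
    (fun s => marg s η η) (fun s => by
      refine tendsto_const_nhds.congr fun n => ?_
      have hne : ((1 / ((n : ℝ) + 1) : ℝ) : ℂ) ≠ 0 := by
        exact_mod_cast (by positivity : (1 / ((n : ℝ) + 1)) ≠ 0)
      rw [marg_add_smul, hψ, hη, smul_zero, add_zero, add_sub_cancel_left, smul_smul,
        Complex.ofReal_mul, inv_mul_cancel₀ (mul_ne_zero hne hne), one_smul])
  rw [sum_mul_marg_diag_re] at key
  simpa only [Complex.star_def, Complex.mul_conj, Complex.ofReal_re] using key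

end Variation

section Tangent

variable {H lam : ∀ s, Fin (d s) → ℝ} (hlam : ∀ s, StrictAnti (lam s))
  {ψ : (∀ s, Fin (d s)) → ℂ} (hψ : ∀ s, marg s ψ ψ = rdiag (lam s))

lemma trace_mul_rdiag {n : ℕ} (A : Matrix (Fin n) (Fin n) ℂ) (x : Fin n → ℝ) :
    trace (A * rdiag x) = ∑ i, A i i * (x i : ℂ) := by
  rw [rdiag, trace]
  exact Finset.sum_congr rfl fun i _ => mul_diagonal _ _ _ _

lemma star_dotProduct_self_eq {ι : Type*} [Fintype ι] (v : ι → ℂ) :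
    star v ⬝ᵥ v = ((∑ p, Complex.normSq (v p) : ℝ) : ℂ) := by
  simp [dotProduct, Complex.normSq_eq_conj_mul_self]

lemma star_sum_dotProduct_sum (X Y : ∀ s, Matrix (Fin (d s)) (Fin (d s)) ℂ)
    (ψ : (∀ s, Fin (d s)) → ℂ) :
    star (∑ s, legOp s (X s) ψ) ⬝ᵥ ∑ s, legOp s (Y s) ψ
      = ∑ s, ∑ t, star ψ ⬝ᵥ legOp s (X s)ᴴ (legOp t (Y t) ψ) := by
  rw [star_sum, sum_dotProduct]
  refine Finset.sum_congr rfl fun s _ => ?_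
  rw [dotProduct_sum]
  exact Finset.sum_congr rfl fun t _ => star_legOp_dotProduct _ _ _ _

include hψ in
lemma star_dotProduct_commutator (X : ∀ s, Matrix (Fin (d s)) (Fin (d s)) ℂ) :
    star (∑ s, legOp s (X s)ᴴ ψ) ⬝ᵥ ∑ s, legOp s (X s)ᴴ ψ
      - star (∑ s, legOp s (X s) ψ) ⬝ᵥ ∑ s, legOp s (X s) ψ
      = ((∑ s, ∑ i, ∑ j, Complex.normSq (X s i j) * (lam s i - lam s j) : ℝ) : ℂ) := by
  rw [star_sum_dotProduct_sum, star_sum_dotProduct_sum]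
  rw [Finset.sum_comm (f := fun s t => star ψ ⬝ᵥ legOp s (X s)ᴴ (legOp t (X t) ψ)),
    ← Finset.sum_sub_distrib]
  push_cast
  refine Finset.sum_congr rfl fun s _ => ?_
  rw [← Finset.sum_sub_distrib, Finset.sum_eq_single s]
  · rw [legOp_legOp, legOp_legOp, dotProduct_legOp, dotProduct_legOp, hψ,
      conjTranspose_conjTranspose, trace_mul_rdiag, trace_mul_rdiag]
    simp only [mul_apply, conjTranspose_apply, mul_sub, Finset.sum_sub_distrib, Finset.sum_mul]
    congr 1
    · refine Finset.sum_congr rfl fun i _ => Finset.sum_congr rfl fun j _ => ?_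
      rw [Complex.star_def, Complex.mul_conj]
    · rw [Finset.sum_comm]
      refine Finset.sum_congr rfl fun i _ => Finset.sum_congr rfl fun j _ => ?_
      rw [Complex.star_def, mul_comm ((starRingEnd ℂ) _), Complex.mul_conj]
  · intro t _ ht
    rw [conjTranspose_conjTranspose, legOp_comm ht.symm, sub_self]
  · simp

include hlam hψ in
lemma eq_zero_of_sum_legOp_eq_zero (X : ∀ s, Matrix (Fin (d s)) (Fin (d s)) ℂ)
    (hX : ∀ s i j, X s i j ≠ 0 → j < i) (h : ∑ s, legOp s (X s) ψ = 0) (s : S)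
    (i j : Fin (d s)) : X s i j = 0 := by
  have h1 := star_dotProduct_commutator hψ X
  rw [h, star_zero, zero_dotProduct, sub_zero] at h1
  have h2 : (0 : ℝ) ≤ ∑ s, ∑ i, ∑ j, Complex.normSq (X s i j) * (lam s i - lam s j) := by
    rw [star_dotProduct_self_eq] at h1
    rw [← Complex.ofReal_injective h1]
    exact Finset.sum_nonneg fun p _ => Complex.normSq_nonneg _
  have hterm : ∀ s i j, Complex.normSq (X s i j) * (lam s i - lam s j) ≤ 0 := by
    intro s i j
    by_cases hx : X s i j = 0
    · simp [hx]
    · exact mul_nonpos_of_nonneg_of_nonpos (Complex.normSq_nonneg _)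
        (sub_nonpos.2 (hlam s (hX s i j hx)).le)
  have hi : ∀ s i, ∑ j, Complex.normSq (X s i j) * (lam s i - lam s j) ≤ 0 :=
    fun s i => Finset.sum_nonpos fun j _ => hterm s i j
  have hs : ∀ s, ∑ i, ∑ j, Complex.normSq (X s i j) * (lam s i - lam s j) ≤ 0 :=
    fun s => Finset.sum_nonpos fun i _ => hi s i
  have e1 := (Finset.sum_eq_zero_iff_of_nonpos fun s _ => hs s).1
    (le_antisymm (Finset.sum_nonpos fun s _ => hs s) h2) s (Finset.mem_univ s)
  have e2 := (Finset.sum_eq_zero_iff_of_nonpos fun i _ => hi s i).1 e1 i (Finset.mem_univ i)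
  have e3 := (Finset.sum_eq_zero_iff_of_nonpos fun j _ => hterm s i j).1 e2 j (Finset.mem_univ j)
  by_contra hx
  rcases mul_eq_zero.1 e3 with h | h
  · exact hx (Complex.normSq_eq_zero.1 h)
  · exact absurd (hlam s (hX s i j hx)) (by linarith)

end Tangent

end

section

open Matrix Function Filter Topology

variable {S : Type*} [Fintype S] [DecidableEq S] {d : S → ℕ}

section Tangent

variable {H lam : ∀ s, Fin (d s) → ℝ} {ψ : (∀ s, Fin (d s)) → ℂ}

lemma marg_sum_left {ι : Type*} (T : Finset ι) (s : S) (φ : ι → (∀ s, Fin (d s)) → ℂ)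
    (ψ : (∀ s, Fin (d s)) → ℂ) : marg s (∑ t ∈ T, φ t) ψ = ∑ t ∈ T, marg s (φ t) ψ :=
  map_sum (AddMonoidHom.mk' (fun φ => marg s φ ψ) fun φ φ' => marg_add_left s φ φ' ψ) φ T

lemma marg_sum_right {ι : Type*} (T : Finset ι) (s : S) (φ : ι → (∀ s, Fin (d s)) → ℂ)
    (ψ : (∀ s, Fin (d s)) → ℂ) : marg s ψ (∑ t ∈ T, φ t) = ∑ t ∈ T, marg s ψ (φ t) :=
  map_sum (AddMonoidHom.mk' (fun φ => marg s ψ φ) fun φ φ' => marg_add_right s ψ φ φ') φ T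

lemma legOp_neg (s : S) (X : Matrix (Fin (d s)) (Fin (d s)) ℂ) (ψ : (∀ s, Fin (d s)) → ℂ) :
    legOp s (-X) ψ = -legOp s X ψ := by
  funext p
  simp [legOp]

/-- Moving along anti-Hermitian directions changes the marginals by commutators. -/
lemma marg_sum_legOp_add (hψ : ∀ s, marg s ψ ψ = rdiag (lam s))
    (X : ∀ s, Matrix (Fin (d s)) (Fin (d s)) ℂ) (hX : ∀ s, (X s)ᴴ = -X s) (s : S) :
    marg s (∑ t, legOp t (X t) ψ) ψ + marg s ψ (∑ t, legOp t (X t) ψ)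
      = X s * rdiag (lam s) - rdiag (lam s) * X s := by
  rw [marg_sum_left, marg_sum_right, ← Finset.sum_add_distrib, Finset.sum_eq_single s]
  · rw [marg_legOp_left, marg_legOp_right, hψ, hX, Matrix.mul_neg, sub_eq_add_neg]
  · intro t _ ht
    rw [marg_legOp_of_ne ht.symm, hX, ← marg_add_right, legOp_neg, neg_add_cancel, marg,
      ← Matrix.ext_iff]
    simp
  · simp

lemma re_trace_mul_eq_zero {n : ℕ} {Y N : Matrix (Fin n) (Fin n) ℂ} (hY : Yᴴ = Y)
    (hN : Nᴴ = -N) : (trace (Y * N)).re = 0 := by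
  have h : star (trace (Y * N)) = -trace (Y * N) := by
    rw [← trace_conjTranspose, conjTranspose_mul, hY, hN, Matrix.neg_mul, trace_neg,
      trace_mul_comm]
  have := congrArg Complex.re h
  simp only [Complex.star_def, Complex.conj_re, Complex.neg_re] at this
  linarith

lemma sum_weight_mul_legOp (hw : ∀ p, ψ p ≠ 0 → weight H p = 0)
    (X : ∀ s, Matrix (Fin (d s)) (Fin (d s)) ℂ) (p : ∀ s, Fin (d s)) :
    (weight H p : ℂ) * (∑ s, legOp s (X s) ψ) p
      = (∑ s, legOp s (Matrix.of fun i j => ((H s i - H s j : ℝ) : ℂ) * X s i j) ψ) p := by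
  simp only [Finset.sum_apply, legOp, Finset.mul_sum, of_apply]
  refine Finset.sum_congr rfl fun s _ => Finset.sum_congr rfl fun j _ => ?_
  by_cases hp : ψ (update p s j) = 0
  · simp [hp]
  · have := hw _ hp
    rw [weight_update] at this
    rw [show weight H p = H s (p s) - H s j by linarith]
    ring

lemma eq_zero_of_marg_eq_zero (hlam : ∀ s, StrictAnti (lam s))
    (hψ : ∀ s, marg s ψ ψ = rdiag (lam s)) (hw : ∀ p, ψ p ≠ 0 → weight H p = 0)
    (h2 : ∀ η : (∀ s, Fin (d s)) → ℂ, (∀ s, marg s η ψ + marg s ψ η = 0) →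
      0 ≤ ∑ p, weight H p * Complex.normSq (η p))
    (δ : (∀ s, Fin (d s)) → ℂ) (hδ : ∀ p, δ p ≠ 0 → weight H p < 0)
    (h : ∀ s i j, j < i → H s i < H s j → marg s δ ψ i j = 0) : δ = 0 := by
  set D : ∀ s, Matrix (Fin (d s)) (Fin (d s)) ℂ := fun s => marg s δ ψ with hD
  have hDH : ∀ s i j, D s i j ≠ 0 → H s i < H s j ∧ i < j := by
    intro s i j hij
    have hlt : H s i < H s j := by
      by_contra hle
      refine hij (Finset.sum_eq_zero fun p _ => ?_)
      split_ifs with hp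
      · by_contra hne
        have h1 := hδ p (left_ne_zero_of_mul hne)
        have h3 := hw _ (star_ne_zero.1 (right_ne_zero_of_mul hne))
        rw [weight_update, hp] at h3
        linarith
      · rfl
    refine ⟨hlt, lt_of_le_of_ne (not_lt.1 fun hji => hij (h s i j hji hlt)) ?_⟩
    rintro rfl
    exact lt_irrefl _ hlt
  set M : ∀ s, Matrix (Fin (d s)) (Fin (d s)) ℂ := fun s => D s + (D s)ᴴ with hM
  have hMM : ∀ s i j, star (M s i j) = M s j i := by
    intro s i j
    simp [hM, add_comm]
  set X : ∀ s, Matrix (Fin (d s)) (Fin (d s)) ℂ := fun s => Matrix.of fun i j =>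
    M s i j / ((lam s i - lam s j : ℝ) : ℂ) with hX
  have hXX : ∀ s i j, star (X s j i) = -X s i j := by
    intro s i j
    simp only [hX, of_apply, star_div₀, hMM, Complex.star_def, Complex.conj_ofReal]
    rw [← neg_sub (lam s i), Complex.ofReal_neg, div_neg]
  have hXH : ∀ s, (X s)ᴴ = -X s := by
    intro s
    ext i j
    exact hXX s i j
  set χ : (∀ s, Fin (d s)) → ℂ := ∑ s, legOp s (X s) ψ with hχ
  set Y : ∀ s, Matrix (Fin (d s)) (Fin (d s)) ℂ := fun s => Matrix.of fun i j =>
    ((H s i - H s j : ℝ) : ℂ) * X s i j with hY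
  have hYH : ∀ s, (Y s)ᴴ = Y s := by
    intro s
    ext i j
    simp only [hY, conjTranspose_apply, of_apply, star_mul', hXX]
    rw [Complex.star_def, Complex.conj_ofReal]
    push_cast
    ring
  set y : (∀ s, Fin (d s)) → ℂ := ∑ s, legOp s (Y s) ψ with hy
  have hyχ : ∀ p, (weight H p : ℂ) * χ p = y p := fun p => sum_weight_mul_legOp hw X p
  have hηm : ∀ s, marg s (δ + χ) ψ + marg s ψ (δ + χ) = 0 := by
    intro s
    have h1 := marg_sum_legOp_add hψ X hXH s
    have h3 : X s * rdiag (lam s) - rdiag (lam s) * X s = -M s := by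
      ext i j
      rw [Matrix.sub_apply, rdiag, mul_diagonal, diagonal_mul, Matrix.neg_apply]
      by_cases hij : i = j
      · subst hij
        have : D s i i = 0 := by
          by_contra hc
          exact lt_irrefl _ (hDH s i i hc).2
        simp [hM, this, mul_comm]
      · have hne : ((lam s i : ℂ) - lam s j) ≠ 0 := by
          rw [sub_ne_zero]
          exact_mod_cast fun hc => hij ((hlam s).injective hc)
        simp only [hX, of_apply, Complex.ofReal_sub]
        field_simp
        ring
    rw [h3, ← hχ] at h1
    have h4 : M s = marg s δ ψ + marg s ψ δ := by
      rw [hM, ← conjTranspose_marg s δ ψ]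
    rw [marg_add_left, marg_add_right, add_add_add_comm, ← h4, h1, add_neg_cancel]
  have hpos := h2 (δ + χ) hηm
  have hre : ∀ (s : S) (φ : (∀ s, Fin (d s)) → ℂ),
      star (legOp s (Y s) ψ) ⬝ᵥ φ = trace (Y s * marg s φ ψ) := by
    intro s φ
    rw [star_legOp_dotProduct, hYH, dotProduct_legOp]
  have hyη : (star y ⬝ᵥ (δ + χ)).re = 0 := by
    rw [hy, star_sum, sum_dotProduct, Complex.re_sum]
    refine Finset.sum_eq_zero fun s _ => ?_
    rw [hre]
    refine re_trace_mul_eq_zero (hYH s) ?_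
    rw [conjTranspose_marg]
    exact eq_neg_of_add_eq_zero_right (hηm s)
  have hyδ : (star y ⬝ᵥ δ).re ≤ 0 := by
    rw [hy, star_sum, sum_dotProduct, Complex.re_sum]
    refine Finset.sum_nonpos fun s _ => ?_
    rw [hre, trace, Complex.re_sum]
    refine Finset.sum_nonpos fun i _ => ?_
    rw [Matrix.diag_apply, mul_apply, Complex.re_sum]
    refine Finset.sum_nonpos fun j _ => ?_
    by_cases hji : D s j i = 0
    · rw [show marg s δ ψ j i = 0 from hji, mul_zero, Complex.zero_re]
    · obtain ⟨hH, hlt⟩ := hDH s j i hji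
      have hij : D s i j = 0 := by
        by_contra hc
        exact lt_asymm hlt (hDH s i j hc).2
      have e : Y s i j * marg s δ ψ j i
          = (((H s i - H s j) * Complex.normSq (D s j i) / (lam s i - lam s j) : ℝ) : ℂ) := by
        simp only [hY, hX, hM, of_apply, Matrix.add_apply, conjTranspose_apply, hij, zero_add]
        rw [Complex.ofReal_div, Complex.ofReal_mul, Complex.normSq_eq_conj_mul_self,
          Complex.star_def]
        ring
      rw [e, Complex.ofReal_re]
      exact div_nonpos_of_nonneg_of_nonpos
        (mul_nonneg (sub_nonneg.2 hH.le) (Complex.normSq_nonneg _))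
        (sub_nonpos.2 (hlam s hlt).le)
  have hexp : ∑ p, weight H p * Complex.normSq ((δ + χ) p)
      = ∑ p, weight H p * Complex.normSq (δ p) + (star y ⬝ᵥ δ).re
        + (star y ⬝ᵥ (δ + χ)).re := by
    simp only [dotProduct, Complex.re_sum, ← Finset.sum_add_distrib]
    refine Finset.sum_congr rfl fun p _ => ?_
    simp only [Pi.star_apply, ← hyχ, Pi.add_apply, Complex.normSq_apply, star_mul',
      Complex.star_def, Complex.conj_ofReal, Complex.mul_re, Complex.mul_im, Complex.conj_re,
      Complex.conj_im, Complex.add_re, Complex.add_im, Complex.ofReal_re, Complex.ofReal_im]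
    ring
  rw [hexp, hyη, add_zero] at hpos
  have hterm : ∀ p ∈ Finset.univ, weight H p * Complex.normSq (δ p) ≤ 0 := by
    intro p _
    by_cases hp : δ p = 0
    · simp [hp]
    · exact mul_nonpos_of_nonpos_of_nonneg (hδ p hp).le (Complex.normSq_nonneg _)
  have hz := (Finset.sum_eq_zero_iff_of_nonpos hterm).1
    (le_antisymm (Finset.sum_nonpos hterm) (by linarith))
  funext p
  by_contra hp
  rcases mul_eq_zero.1 (hz p (Finset.mem_univ p)) with h' | h'
  · exact (hδ p hp).ne h'
  · exact hp (Complex.normSq_eq_zero.1 h')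

end Tangent

lemma legOp_add (s : S) (X Y : Matrix (Fin (d s)) (Fin (d s)) ℂ) (ψ : (∀ s, Fin (d s)) → ℂ) :
    legOp s (X + Y) ψ = legOp s X ψ + legOp s Y ψ := by
  funext p
  simp [legOp, add_mul, Finset.sum_add_distrib]

lemma legOp_smul (s : S) (c : ℂ) (X : Matrix (Fin (d s)) (Fin (d s)) ℂ)
    (ψ : (∀ s, Fin (d s)) → ℂ) : legOp s (c • X) ψ = c • legOp s X ψ := by
  funext p
  simp [legOp, mul_assoc, Finset.mul_sum]

/-- The inversions of `H`, over all legs. -/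
abbrev Inversions (H : ∀ s, Fin (d s) → ℝ) : Type _ :=
  Σ s, {q : Fin (d s) × Fin (d s) // q.1 < q.2 ∧ H s q.2 < H s q.1}

/-- The basis vectors of negative weight. -/
abbrev NegIndex (H : ∀ s, Fin (d s) → ℝ) : Type _ := {p : ∀ s, Fin (d s) // weight H p < 0}

/-- The strictly lower triangular matrices with prescribed entries at the inversions. -/
def lowerMatrix (H : ∀ s, Fin (d s) → ℝ) (f : Inversions H → ℂ) (s : S) :
    Matrix (Fin (d s)) (Fin (d s)) ℂ :=
  Matrix.of fun i j => if h : j < i ∧ H s i < H s j then f ⟨s, ⟨(j, i), h⟩⟩ else 0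

lemma lowerMatrix_ne_zero {H : ∀ s, Fin (d s) → ℝ} {f : Inversions H → ℂ} {s : S}
    {i j : Fin (d s)} (h : lowerMatrix H f s i j ≠ 0) : j < i ∧ H s i < H s j := by
  by_contra hc
  exact h (by rw [lowerMatrix, of_apply, dif_neg hc])

/-- The infinitesimal action of lower triangular matrices, projected to negative weights. -/
def tangentMap (H : ∀ s, Fin (d s) → ℝ) (ψ : (∀ s, Fin (d s)) → ℂ) :
    (Inversions H → ℂ) →ₗ[ℂ] (NegIndex H → ℂ) where
  toFun f p := (∑ s, legOp s (lowerMatrix H f s) ψ) p.1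
  map_add' f g := by
    have : ∀ s, lowerMatrix H (f + g) s = lowerMatrix H f s + lowerMatrix H g s := by
      intro s
      ext i j
      simp only [lowerMatrix, of_apply, Matrix.add_apply]
      split_ifs <;> simp
    funext p
    simp only [this, legOp_add, Finset.sum_add_distrib, Pi.add_apply]
  map_smul' c f := by
    have : ∀ s, lowerMatrix H (c • f) s = c • lowerMatrix H f s := by
      intro s
      ext i j
      simp only [lowerMatrix, of_apply, Matrix.smul_apply]
      split_ifs <;> simp
    funext p
    simp only [this, legOp_smul, ← Finset.smul_sum, Pi.smul_apply, RingHom.id_apply]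

/-- Extension by zero from the negative weights. -/
def extendNeg (H : ∀ s, Fin (d s) → ℝ) (g : NegIndex H → ℂ) (p : ∀ s, Fin (d s)) : ℂ :=
  if h : weight H p < 0 then g ⟨p, h⟩ else 0

/-- The matrix entries at the inversions of the mixed marginals. -/
def cotangentMap (H : ∀ s, Fin (d s) → ℝ) (ψ : (∀ s, Fin (d s)) → ℂ) :
    (NegIndex H → ℂ) →ₗ[ℂ] (Inversions H → ℂ) where
  toFun g q := marg q.1 (extendNeg H g) ψ q.2.1.2 q.2.1.1
  map_add' f g := by
    have : extendNeg H (f + g) = extendNeg H f + extendNeg H g := by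
      funext p
      simp only [extendNeg, Pi.add_apply]
      split_ifs <;> simp
    funext q
    rw [this, marg_add_left]
    rfl
  map_smul' c f := by
    have : extendNeg H (c • f) = c • extendNeg H f := by
      funext p
      simp only [extendNeg, Pi.smul_apply]
      split_ifs <;> simp
    funext q
    rw [this, marg_smul_left]
    rfl

theorem card_neg_eq_card_inversions {H lam : ∀ s, Fin (d s) → ℝ}
    (hpos : ∀ μ ∈ cone d, 0 ≤ pairing H μ) (hlam : ∀ s, StrictAnti (lam s))
    (h0 : pairing H lam = 0) (hmem : lam ∈ cone d) :
    Nat.card (NegIndex H) = ∑ s, Nat.card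
      {q : Fin (d s) × Fin (d s) // q.1 < q.2 ∧ H s q.2 < H s q.1} := by
  obtain ⟨-, ψ, hψ⟩ := hmem
  have hw := weight_eq_zero_of_ne_zero hpos hlam h0 hψ
  have h2 := second_variation hpos hlam h0 hψ
  have hsig : Nat.card (Inversions H) = ∑ s, Nat.card
      {q : Fin (d s) × Fin (d s) // q.1 < q.2 ∧ H s q.2 < H s q.1} := Nat.card_sigma
  rw [← hsig, Nat.card_eq_fintype_card, Nat.card_eq_fintype_card]
  have hT : Injective (tangentMap H ψ) := by
    refine (injective_iff_map_eq_zero _).2 fun f hf => ?_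
    have hsum : ∑ s, legOp s (lowerMatrix H f s) ψ = 0 := by
      funext p
      by_cases hp : weight H p < 0
      · exact congrFun hf ⟨p, hp⟩
      · rw [Finset.sum_apply]
        refine Finset.sum_eq_zero fun s _ => Finset.sum_eq_zero fun j _ => ?_
        by_contra hne
        have h1 := lowerMatrix_ne_zero (left_ne_zero_of_mul hne)
        have h3 := hw _ (right_ne_zero_of_mul hne)
        rw [weight_update] at h3
        linarith [h1.2]
    have hz := eq_zero_of_sum_legOp_eq_zero hlam hψ (lowerMatrix H f)
      (fun s i j hij => (lowerMatrix_ne_zero hij).1) hsum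
    funext q
    obtain ⟨s, ⟨⟨i, j⟩, hq⟩⟩ := q
    have := hz s j i
    rwa [lowerMatrix, of_apply, dif_pos hq] at this
  have hC : Injective (cotangentMap H ψ) := by
    refine (injective_iff_map_eq_zero _).2 fun g hg => ?_
    have hz : extendNeg H g = 0 := by
      refine eq_zero_of_marg_eq_zero hlam hψ hw h2 _ (fun p hp => ?_) fun s i j hji hH =>
        congrFun hg ⟨s, ⟨(j, i), hji, hH⟩⟩
      by_contra hc
      exact hp (by rw [extendNeg, dif_neg hc])
    funext p
    have := congrFun hz p.1
    rwa [extendNeg, dif_pos p.2] at this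
  refine le_antisymm ?_ ?_
  · simpa using LinearMap.finrank_le_finrank_of_injective hC
  · simpa using LinearMap.finrank_le_finrank_of_injective hT

end

section

open MvPolynomial

section Fischer

variable {σ : Type*} [Fintype σ]

/-- The factorial of a multi-index. -/
def multiFactorial (α : σ →₀ ℕ) : ℕ := ∏ p, (α p).factorial

lemma multiFactorial_pos (α : σ →₀ ℕ) : 0 < multiFactorial α :=
  Finset.prod_pos fun _ _ => Nat.factorial_pos _

lemma multiFactorial_single_add (p : σ) (α : σ →₀ ℕ) :
    multiFactorial (Finsupp.single p 1 + α) = (α p + 1) * multiFactorial α := by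
  classical
  unfold multiFactorial
  rw [← Finset.mul_prod_erase _ _ (Finset.mem_univ p),
    ← Finset.mul_prod_erase (a := p) _ _ (Finset.mem_univ p), ← mul_assoc]
  congr 1
  · simp [add_comm 1, Nat.factorial_succ]
  · refine Finset.prod_congr rfl fun q hq => ?_
    simp [Finsupp.single_eq_of_ne (Finset.ne_of_mem_erase hq)]

/-- The Fischer inner product of polynomials. -/
def fischer (P Q : MvPolynomial σ ℂ) : ℂ :=
  ∑ α ∈ P.support, (multiFactorial α : ℂ) * (star (coeff α P) * coeff α Q)

lemma fischer_eq_sum {P Q : MvPolynomial σ ℂ} {T : Finset (σ →₀ ℕ)} (hT : P.support ⊆ T) :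
    fischer P Q = ∑ α ∈ T, (multiFactorial α : ℂ) * (star (coeff α P) * coeff α Q) :=
  Finset.sum_subset hT fun α _ hα => by simp [notMem_support_iff.1 hα]

lemma fischer_add_left (P P' Q : MvPolynomial σ ℂ) :
    fischer (P + P') Q = fischer P Q + fischer P' Q := by
  classical
  rw [fischer_eq_sum (T := P.support ∪ P'.support) support_add,
    fischer_eq_sum (T := P.support ∪ P'.support) Finset.subset_union_left,
    fischer_eq_sum (T := P.support ∪ P'.support) Finset.subset_union_right,
    ← Finset.sum_add_distrib]
  refine Finset.sum_congr rfl fun α _ => ?_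
  rw [coeff_add, star_add]
  ring

lemma fischer_smul_left (c : ℂ) (P Q : MvPolynomial σ ℂ) :
    fischer (c • P) Q = star c * fischer P Q := by
  rw [fischer_eq_sum (T := P.support) support_smul, fischer, Finset.mul_sum]
  refine Finset.sum_congr rfl fun α _ => ?_
  rw [coeff_smul, smul_eq_mul, star_mul']
  ring

lemma star_fischer (P Q : MvPolynomial σ ℂ) : star (fischer P Q) = fischer Q P := by
  classical
  rw [fischer_eq_sum (T := P.support ∪ Q.support) Finset.subset_union_left,
    fischer_eq_sum (T := P.support ∪ Q.support) Finset.subset_union_right, star_sum]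
  refine Finset.sum_congr rfl fun α _ => ?_
  rw [star_mul', star_mul', star_star, star_natCast]
  ring

lemma fischer_add_right (P Q Q' : MvPolynomial σ ℂ) :
    fischer P (Q + Q') = fischer P Q + fischer P Q' := by
  rw [← star_fischer, fischer_add_left, star_add, star_fischer, star_fischer]

lemma fischer_smul_right (c : ℂ) (P Q : MvPolynomial σ ℂ) :
    fischer P (c • Q) = c * fischer P Q := by
  rw [← star_fischer, fischer_smul_left, star_mul', star_fischer, star_star]

lemma fischer_zero_left (Q : MvPolynomial σ ℂ) : fischer 0 Q = 0 := by
  simp [fischer]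

lemma fischer_zero_right (P : MvPolynomial σ ℂ) : fischer P 0 = 0 := by
  simp [fischer]

lemma fischer_sub_right (P Q Q' : MvPolynomial σ ℂ) :
    fischer P (Q - Q') = fischer P Q - fischer P Q' := by
  rw [eq_sub_iff_add_eq, ← fischer_add_right, sub_add_cancel]

lemma fischer_sum_left {ι : Type*} (T : Finset ι) (f : ι → MvPolynomial σ ℂ)
    (Q : MvPolynomial σ ℂ) : fischer (∑ i ∈ T, f i) Q = ∑ i ∈ T, fischer (f i) Q :=
  map_sum (AddMonoidHom.mk' (fun P => fischer P Q) fun P P' => fischer_add_left P P' Q) f T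

lemma fischer_sum_right {ι : Type*} (T : Finset ι) (f : ι → MvPolynomial σ ℂ)
    (P : MvPolynomial σ ℂ) : fischer P (∑ i ∈ T, f i) = ∑ i ∈ T, fischer P (f i) :=
  map_sum (AddMonoidHom.mk' (fun Q => fischer P Q) fun Q Q' => fischer_add_right P Q Q') f T

lemma fischer_self (P : MvPolynomial σ ℂ) : fischer P P
    = ((∑ α ∈ P.support, multiFactorial α * Complex.normSq (coeff α P) : ℝ) : ℂ) := by
  rw [fischer]
  push_cast
  refine Finset.sum_congr rfl fun α _ => ?_
  rw [Complex.normSq_eq_conj_mul_self, Complex.star_def]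

lemma fischer_self_re_nonneg (P : MvPolynomial σ ℂ) : 0 ≤ (fischer P P).re := by
  rw [fischer_self, Complex.ofReal_re]
  exact Finset.sum_nonneg fun α _ => mul_nonneg (Nat.cast_nonneg _) (Complex.normSq_nonneg _)

lemma eq_zero_of_fischer_self {P : MvPolynomial σ ℂ} (h : (fischer P P).re = 0) : P = 0 := by
  rw [fischer_self, Complex.ofReal_re, Finset.sum_eq_zero_iff_of_nonneg fun α _ =>
    mul_nonneg (Nat.cast_nonneg _) (Complex.normSq_nonneg _)] at h
  by_contra hP
  obtain ⟨α, hα⟩ := support_nonempty.2 hP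
  have h1 := h α hα
  have h2 : (multiFactorial α : ℝ) ≠ 0 := by exact_mod_cast (multiFactorial_pos α).ne'
  rcases mul_eq_zero.1 h1 with h3 | h3
  · exact h2 h3
  · exact mem_support_iff.1 hα (Complex.normSq_eq_zero.1 h3)

lemma fischer_self_re_pos {P : MvPolynomial σ ℂ} (h : P ≠ 0) : 0 < (fischer P P).re :=
  lt_of_le_of_ne (fischer_self_re_nonneg P) fun h0 => h (eq_zero_of_fischer_self h0.symm)

lemma fischer_X_mul (p : σ) (P Q : MvPolynomial σ ℂ) :
    fischer (X p * P) Q = fischer P (pderiv p Q) := by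
  rw [fischer, support_X_mul, Finset.sum_map, fischer]
  refine Finset.sum_congr rfl fun α _ => ?_
  rw [addLeftEmbedding_apply, coeff_X_mul, multiFactorial_single_add, coeff_pderiv,
    add_comm (Finsupp.single p 1)]
  push_cast
  ring

lemma fischer_pderiv (p : σ) (P Q : MvPolynomial σ ℂ) :
    fischer (pderiv p P) Q = fischer P (X p * Q) := by
  rw [← star_fischer, ← fischer_X_mul, star_fischer]

/-- The linear form with coefficients conjugate to `ψ`. -/
def conjForm (ψ : σ → ℂ) : MvPolynomial σ ℂ := ∑ p, star (ψ p) • X p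

lemma fischer_conjForm_mul (ψ : σ → ℂ) (P Q : MvPolynomial σ ℂ) :
    fischer (conjForm ψ * P) Q = fischer P (∑ p, ψ p • pderiv p Q) := by
  rw [conjForm, Finset.sum_mul, fischer_sum_left, fischer_sum_right]
  refine Finset.sum_congr rfl fun p _ => ?_
  rw [smul_mul_assoc, fischer_smul_left, fischer_smul_right, fischer_X_mul, star_star]

lemma fischer_conjForm_pow (ψ : σ → ℂ) (n : ℕ) {Q : MvPolynomial σ ℂ} (hQ : Q.IsHomogeneous n) :
    fischer (conjForm ψ ^ n) Q = n.factorial * eval ψ Q := by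
  classical
  induction n generalizing Q with
  | zero =>
    have hc := totalDegree_eq_zero_iff_eq_C.1 ((totalDegree_zero_iff_isHomogeneous _).2 hQ)
    rw [hc, pow_zero, fischer_eq_sum (T := {0}) (by
      rw [← C_1, C_apply]
      exact support_monomial_subset)]
    simp [multiFactorial]
  | succ n ih =>
    have hd : (∑ p, ψ p • pderiv p Q).IsHomogeneous n :=
      IsHomogeneous.sum _ _ _ fun p _ => by
        rw [smul_eq_C_mul]
        simpa using (isHomogeneous_C σ (ψ p)).mul (hQ.pderiv (i := p))
    have he := congrArg (eval ψ) hQ.sum_X_mul_pderiv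
    simp only [map_sum, map_mul, eval_X, map_nsmul] at he
    rw [pow_succ', fischer_conjForm_mul, ih hd, map_sum]
    simp only [smul_eval]
    rw [he, Nat.factorial_succ, nsmul_eq_mul]
    push_cast
    ring

end Fischer

end

section

open MvPolynomial Function

variable {S : Type*} [Fintype S] [DecidableEq S] {d : S → ℕ}

/-- The action of the matrix unit `(i, j)` on the leg `s` as a derivation of the polynomial ring
on tensors. -/
def matUnit (s : S) (i j : Fin (d s)) :
    Derivation ℂ (MvPolynomial (∀ s, Fin (d s)) ℂ) (MvPolynomial (∀ s, Fin (d s)) ℂ) :=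
  mkDerivation ℂ fun q => if q s = j then X (update q s i) else 0

lemma matUnit_X (s : S) (i j : Fin (d s)) (q : ∀ s, Fin (d s)) :
    matUnit s i j (X q) = if q s = j then X (update q s i) else 0 := mkDerivation_X _ _ _

lemma matUnit_apply (s : S) (i j : Fin (d s)) (P : MvPolynomial (∀ s, Fin (d s)) ℂ) :
    matUnit s i j P = ∑ q, if q s = j then X (update q s i) * pderiv q P else 0 := by
  have h : matUnit s i j
      = ∑ q : ∀ s, Fin (d s), if q s = j then
        (X (update q s i) : MvPolynomial (∀ s, Fin (d s)) ℂ) • pderiv q else 0 := by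
    refine derivation_ext fun r => ?_
    rw [matUnit_X, ← Derivation.coeFnAddMonoidHom_apply, map_sum, Finset.sum_apply,
      Finset.sum_eq_single r]
    · split_ifs <;> simp
    · intro q _ hq
      split_ifs
      · simp [pderiv_X_of_ne hq.symm]
      · simp
    · simp
  rw [h, ← Derivation.coeFnAddMonoidHom_apply, map_sum, Finset.sum_apply]
  refine Finset.sum_congr rfl fun q _ => ?_
  split_ifs <;> simp

lemma matUnit_isHomogeneous (s : S) (i j : Fin (d s)) {P : MvPolynomial (∀ s, Fin (d s)) ℂ}
    {n : ℕ} (hP : P.IsHomogeneous n) : (matUnit s i j P).IsHomogeneous n := by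
  rcases n with _ | n
  · rw [totalDegree_eq_zero_iff_eq_C.1 ((totalDegree_zero_iff_isHomogeneous _).2 hP),
      derivation_C]
    exact isHomogeneous_zero _ _ _
  · rw [matUnit_apply]
    refine IsHomogeneous.sum _ _ _ fun q _ => ?_
    split_ifs
    · simpa [add_comm] using (isHomogeneous_X ℂ (update q s i)).mul (hP.pderiv (i := q))
    · exact isHomogeneous_zero _ _ _

lemma sum_ite_update_swap {M : Type*} [AddCommMonoid M] (s : S) (i j : Fin (d s))
    (f : (∀ s, Fin (d s)) → (∀ s, Fin (d s)) → M) :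
    (∑ q, if q s = j then f q (update q s i) else 0)
      = ∑ q, if q s = i then f (update q s j) q else 0 := by
  have h := sum_update_swap (d := d) s fun p q => if p s = j ∧ q s = i then f p q else 0
  have e1 : ∀ p : ∀ s, Fin (d s), (∑ k, if p s = j ∧ (update p s k) s = i then
      f p (update p s k) else 0) = if p s = j then f p (update p s i) else 0 := by
    intro p
    simp only [update_self, ite_and]
    split_ifs <;> simp
  have e2 : ∀ p : ∀ s, Fin (d s), (∑ k, if (update p s k) s = j ∧ p s = i then
      f (update p s k) p else 0) = if p s = i then f (update p s j) p else 0 := by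
    intro p
    simp only [update_self, ite_and]
    rw [Finset.sum_ite_eq' Finset.univ j, if_pos (Finset.mem_univ j)]
  simpa only [e1, e2] using h

lemma fischer_matUnit (s : S) (i j : Fin (d s)) (P Q : MvPolynomial (∀ s, Fin (d s)) ℂ) :
    fischer (matUnit s i j P) Q = fischer P (matUnit s j i Q) := by
  rw [matUnit_apply, matUnit_apply, fischer_sum_left, fischer_sum_right]
  have h : ∀ q : ∀ s, Fin (d s),
      fischer (if q s = j then X (update q s i) * pderiv q P else 0) Q
        = if q s = j then fischer P (X q * pderiv (update q s i) Q) else 0 := by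
    intro q
    split_ifs
    · rw [fischer_X_mul, fischer_pderiv]
    · exact fischer_zero_left Q
  rw [Finset.sum_congr rfl fun q _ => h q,
    sum_ite_update_swap s i j fun q r => fischer P (X q * pderiv r Q)]
  refine Finset.sum_congr rfl fun q _ => ?_
  split_ifs
  · rfl
  · exact (fischer_zero_right P).symm

/-- The operator underlying `matUnit`. -/
def unitEnd (s : S) (i j : Fin (d s)) : Module.End ℂ (MvPolynomial (∀ s, Fin (d s)) ℂ) :=
  (matUnit s i j).toLinearMap

lemma unitEnd_apply (s : S) (i j : Fin (d s)) (P : MvPolynomial (∀ s, Fin (d s)) ℂ) :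
    unitEnd s i j P = matUnit s i j P := rfl

lemma unitEnd_bracket (s : S) (i j k l : Fin (d s)) :
    unitEnd s i j * unitEnd s k l - unitEnd s k l * unitEnd s i j
      = (if j = k then unitEnd s i l else 0) - if l = i then unitEnd s k j else 0 := by
  have h : ⁅matUnit s i j, matUnit s k l⁆
      = (if j = k then matUnit s i l else 0) - if l = i then matUnit s k j else 0 := by
    refine derivation_ext fun q => ?_
    rw [Derivation.commutator_apply, Derivation.sub_apply, matUnit_X, matUnit_X]
    have e1 : ∀ (c : Prop) [Decidable c] (i j : Fin (d s)),
        (if c then matUnit s i j else 0) (X q)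
          = if c then (if q s = j then X (update q s i) else 0) else 0 := by
      intro c _ i j
      split_ifs <;> simp_all [matUnit_X]
    have e2 : ∀ (c : Prop) [Decidable c] (i j k : Fin (d s)),
        matUnit s i j (if c then X (update q s k) else 0)
          = if c then (if k = j then X (update q s i) else 0) else 0 := by
      intro c _ i j k
      split_ifs <;> simp_all [matUnit_X]
    rw [e1, e1, e2, e2]
    congr 1
    · rw [← ite_and, ← ite_and]
      exact if_congr (by rw [and_comm, eq_comm (a := k)]) rfl rfl
    · rw [← ite_and, ← ite_and]
      exact if_congr (by rw [and_comm, eq_comm (a := i)]) rfl rfl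
  refine LinearMap.ext fun P => ?_
  have := congrArg (fun D => D P) h
  simp only [Derivation.commutator_apply, Derivation.sub_apply] at this
  rw [LinearMap.sub_apply, LinearMap.sub_apply, Module.End.mul_apply, Module.End.mul_apply]
  simp only [unitEnd_apply]
  rw [this]
  congr 1 <;> split_ifs <;> rfl

lemma unitEnd_commute {s t : S} (hst : s ≠ t) (i j : Fin (d s)) (k l : Fin (d t)) :
    Commute (unitEnd s i j) (unitEnd t k l) := by
  have h : ⁅matUnit s i j, matUnit t k l⁆ = 0 := by
    refine derivation_ext fun q => ?_
    rw [Derivation.commutator_apply, matUnit_X, matUnit_X]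
    by_cases h1 : q s = j <;> by_cases h2 : q t = l <;>
      simp [h1, h2, matUnit_X, update_of_ne hst, update_of_ne hst.symm, update_comm hst]
  refine LinearMap.ext fun P => ?_
  have h1 := congrArg (fun D => D P) h
  simp only [Derivation.commutator_apply, Derivation.zero_apply, sub_eq_zero] at h1
  exact h1

/-- The quadratic Casimir operator of the leg `s`. -/
def casimir (s : S) : Module.End ℂ (MvPolynomial (∀ s, Fin (d s)) ℂ) :=
  ∑ i, ∑ j, unitEnd s i j * unitEnd s j i

lemma casimir_commute (s : S) (i j : Fin (d s)) : Commute (casimir s) (unitEnd s i j) := by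
  have h : ∀ k l, unitEnd s k l * unitEnd s l k * unitEnd s i j
      - unitEnd s i j * (unitEnd s k l * unitEnd s l k)
      = unitEnd s k l * ((if k = i then unitEnd s l j else 0) - if j = l then unitEnd s i k else 0)
        + ((if l = i then unitEnd s k j else 0) - if j = k then unitEnd s i l else 0)
          * unitEnd s l k := by
    intro k l
    rw [← unitEnd_bracket, ← unitEnd_bracket]
    simp only [mul_sub, sub_mul, mul_assoc]
    abel
  rw [commute_iff_eq, ← sub_eq_zero, casimir, Finset.sum_mul, Finset.mul_sum,
    ← Finset.sum_sub_distrib]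
  simp only [Finset.sum_mul, Finset.mul_sum, ← Finset.sum_sub_distrib, h]
  simp only [mul_sub, sub_mul, Finset.sum_add_distrib, Finset.sum_sub_distrib, mul_ite, ite_mul,
    mul_zero, zero_mul]
  rw [Finset.sum_comm (f := fun k l => if k = i then unitEnd s k l * unitEnd s l j else 0),
    Finset.sum_comm (f := fun k l => if j = k then unitEnd s i l * unitEnd s l k else 0)]
  simp

/-- The quadratic operator whose lowest eigenvectors are highest weight vectors. -/
def energy (x : ∀ s, Fin (d s) → ℝ) : Module.End ℂ (MvPolynomial (∀ s, Fin (d s)) ℂ) :=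
  ∑ s, (casimir s - ∑ i, (2 * x s i : ℂ) • unitEnd s i i)

lemma energy_bracket (x : ∀ s, Fin (d s) → ℝ) (s : S) (i j : Fin (d s)) :
    energy x * unitEnd s i j - unitEnd s i j * energy x
      = ((-2 * (x s i - x s j) : ℝ) : ℂ) • unitEnd s i j := by
  rw [energy, Finset.sum_mul, Finset.mul_sum, ← Finset.sum_sub_distrib, Finset.sum_eq_single s]
  · rw [sub_mul, mul_sub, (casimir_commute s i j).eq, sub_sub_sub_cancel_left, Finset.mul_sum,
      Finset.sum_mul, ← Finset.sum_sub_distrib]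
    have h : ∀ k, unitEnd s i j * ((2 * x s k : ℂ) • unitEnd s k k)
        - (2 * x s k : ℂ) • unitEnd s k k * unitEnd s i j
        = (if j = k then (2 * x s k : ℂ) • unitEnd s i j else 0)
          - if k = i then (2 * x s k : ℂ) • unitEnd s i j else 0 := by
      intro k
      rw [mul_smul_comm, smul_mul_assoc]
      refine (smul_sub _ _ _).symm.trans ?_
      rw [unitEnd_bracket]
      refine (smul_sub _ _ _).trans ?_
      congr 1
      · split_ifs with hk
        · rw [hk]
        · exact smul_zero _
      · split_ifs with hk
        · rw [hk]
        · exact smul_zero _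
    simp only [h, Finset.sum_sub_distrib, Finset.sum_ite_eq, Finset.sum_ite_eq',
      Finset.mem_univ, if_true]
    refine (sub_smul _ _ _).symm.trans ?_
    congr 1
    push_cast
    ring
  · intro t _ hts
    have h1 : Commute (casimir t) (unitEnd s i j) :=
      Commute.sum_left _ _ _ fun k _ => Commute.sum_left _ _ _ fun l _ =>
        (unitEnd_commute hts k l i j).mul_left (unitEnd_commute hts l k i j)
    have h2 : Commute (∑ k, (2 * x t k : ℂ) • unitEnd t k k) (unitEnd s i j) :=
      Commute.sum_left _ _ _ fun k _ => (unitEnd_commute hts k k i j).smul_left _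
    rw [sub_eq_zero]
    exact (h1.sub_left h2).eq
  · simp

end

section

open MvPolynomial Function

/-- A symmetric operator for a positive definite Hermitian form has a lowest eigenvalue, which
minimises the Rayleigh quotient. -/
lemma exists_lowest_eigenvalue {V : Type*} [AddCommGroup V] [Module ℂ V] [FiniteDimensional ℂ V]
    [Nontrivial V] (B : V → V → ℂ) (hsymm : ∀ v w, star (B v w) = B w v)
    (hadd : ∀ u v w, B (u + v) w = B u w + B v w)
    (hsmul : ∀ (c : ℂ) v w, B (c • v) w = star c * B v w)
    (hpos : ∀ v, v ≠ 0 → 0 < (B v v).re) (T : Module.End ℂ V)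
    (hT : ∀ v w, B (T v) w = B v (T w)) :
    ∃ m : ℝ, (∃ v, v ≠ 0 ∧ T v = (m : ℂ) • v) ∧ ∀ v, m * (B v v).re ≤ (B v (T v)).re := by
  have hzero : ∀ w, B 0 w = 0 := fun w => by simpa using hsmul 0 0 w
  let core : InnerProductSpace.Core ℂ V :=
    { inner := B
      conj_inner_symm := fun v w => hsymm w v
      re_inner_nonneg := fun v => by
        by_cases hv : v = 0
        · simp [hv, hzero]
        · exact (hpos v hv).le
      add_left := hadd
      smul_left := fun v w c => hsmul c v w
      definite := fun v hv => by
        by_contra h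
        have := hpos v h
        rw [hv] at this
        exact lt_irrefl _ this }
  let _ : NormedAddCommGroup V := core.toNormedAddCommGroup
  let _ : InnerProductSpace ℂ V := InnerProductSpace.ofCore core.toCore
  have hinner : ∀ v w : V, inner ℂ v w = B v w := fun _ _ => rfl
  have hsym : T.IsSymmetric := fun v w => hT v w
  have h := hsym.hasEigenvalue_iInf_of_finiteDimensional
  refine ⟨⨅ x : {x : V // x ≠ 0}, (RCLike.re (inner ℂ (T x) (x : V)) / ‖(x : V)‖ ^ 2 : ℝ),
    ?_, fun v => ?_⟩
  · obtain ⟨v, hv⟩ := h.exists_hasEigenvector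
    exact ⟨v, hv.2, hv.apply_eq_smul⟩
  · by_cases hv : v = 0
    · simp [hv, hzero]
    have hb : BddBelow (Set.range fun x : {x : V // x ≠ 0} =>
        (RCLike.re (inner ℂ (T x) (x : V)) / ‖(x : V)‖ ^ 2 : ℝ)) := by
      refine ⟨-‖LinearMap.toContinuousLinearMap T‖, ?_⟩
      rintro _ ⟨⟨x, hx⟩, rfl⟩
      have h1 : 0 < ‖x‖ := norm_pos_iff.2 hx
      simp only
      rw [le_div_iff₀ (by positivity)]
      have h2 := (LinearMap.toContinuousLinearMap T).le_opNorm x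
      have h3 := norm_inner_le_norm (𝕜 := ℂ) (T x) x
      have h4 := neg_le_of_abs_le ((RCLike.abs_re_le_norm (inner ℂ (T x) x)).trans h3)
      have h5 : ‖T x‖ * ‖x‖ ≤ ‖LinearMap.toContinuousLinearMap T‖ * ‖x‖ * ‖x‖ :=
        mul_le_mul_of_nonneg_right h2 h1.le
      nlinarith
    have h1 := ciInf_le hb ⟨v, hv⟩
    simp only at h1
    rw [le_div_iff₀ (by have := norm_pos_iff.2 hv; positivity)] at h1
    rw [← hinner, ← hinner, ← hsym v v]
    have h2 : ‖v‖ ^ 2 = (inner ℂ v v : ℂ).re := norm_sq_eq_re_inner (𝕜 := ℂ) v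
    rw [← h2]
    exact h1

/-- Commuting endomorphisms preserving a nonzero finite-dimensional subspace have a common
eigenvector in it. -/
lemma exists_common_eigenvector {V ι : Type*} [AddCommGroup V] [Module ℂ V]
    (f : ι → Module.End ℂ V) (hf : ∀ k l, Commute (f k) (f l)) (T : Finset ι) :
    ∀ W : Submodule ℂ V, FiniteDimensional ℂ W → W ≠ ⊥ → (∀ k, ∀ v ∈ W, f k v ∈ W) →
      ∃ v ∈ W, v ≠ 0 ∧ ∀ k ∈ T, ∃ c : ℂ, f k v = c • v := by
  classical
  induction T using Finset.induction_on with
  | empty =>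
    intro W _ hW _
    obtain ⟨v, hv, hv0⟩ := W.ne_bot_iff.1 hW
    exact ⟨v, hv, hv0, by simp⟩
  | insert k T _ ih =>
    intro W hfin hW hinv
    have : Nontrivial W := Submodule.nontrivial_iff_ne_bot.2 hW
    obtain ⟨c, hc⟩ := Module.End.exists_eigenvalue ((f k).restrict (hinv k))
    obtain ⟨u, hu⟩ := hc.exists_hasEigenvector
    have hu1 : f k u = c • (u : V) := congrArg Subtype.val hu.apply_eq_smul
    obtain ⟨v, hv, hv0, h⟩ := ih (W ⊓ LinearMap.ker (f k - c • (1 : Module.End ℂ V)))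
      (Submodule.finiteDimensional_inf_left _ _)
      ((Submodule.ne_bot_iff _).2 ⟨u, ⟨u.2, by simp [hu1]⟩, fun h0 => hu.2 (Subtype.ext h0)⟩)
      (fun l v hv => ⟨hinv l v hv.1, by
        have h1 : f k v = c • v := by simpa [sub_eq_zero] using hv.2
        have h2 : f k (f l v) = f l (f k v) := LinearMap.congr_fun (hf k l).eq v
        simp [h2, h1]⟩)
    refine ⟨v, hv.1, hv0, fun l hl => ?_⟩
    rcases Finset.mem_insert.1 hl with rfl | hl
    · exact ⟨c, by simpa [sub_eq_zero] using hv.2⟩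
    · exact h l hl

variable {S : Type*} [Fintype S] [DecidableEq S] {d : S → ℕ}

/-- `P` is a highest weight vector of degree `n` and weight `w`. -/
structure IsHighestWeight (n : ℕ) (w : ∀ s, Fin (d s) → ℝ)
    (P : MvPolynomial (∀ s, Fin (d s)) ℂ) : Prop where
  homogeneous : P.IsHomogeneous n
  ne_zero : P ≠ 0
  weight_eq : ∀ s i, matUnit s i i P = (w s i : ℂ) • P
  raise_eq_zero : ∀ s i j, i < j → matUnit s i j P = 0

lemma IsHighestWeight.mul {m n : ℕ} {w x : ∀ s, Fin (d s) → ℝ}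
    {P Q : MvPolynomial (∀ s, Fin (d s)) ℂ} (hP : IsHighestWeight m w P)
    (hQ : IsHighestWeight n x Q) : IsHighestWeight (m + n) (w + x) (P * Q) where
  homogeneous := hP.homogeneous.mul hQ.homogeneous
  ne_zero := mul_ne_zero hP.ne_zero hQ.ne_zero
  weight_eq s i := by
    rw [Derivation.leibniz, hP.weight_eq, hQ.weight_eq]
    simp only [smul_eq_mul, Pi.add_apply, Complex.ofReal_add, smul_eq_C_mul, C_add]
    ring
  raise_eq_zero s i j hij := by
    rw [Derivation.leibniz, hP.raise_eq_zero s i j hij, hQ.raise_eq_zero s i j hij]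
    simp

lemma matUnit_commutator (s : S) (i j k l : Fin (d s)) (P : MvPolynomial (∀ s, Fin (d s)) ℂ) :
    matUnit s i j (matUnit s k l P) = matUnit s k l (matUnit s i j P)
      + ((if j = k then matUnit s i l P else 0) - if l = i then matUnit s k j P else 0) := by
  have h := LinearMap.congr_fun (unitEnd_bracket s i j k l) P
  rw [LinearMap.sub_apply, LinearMap.sub_apply, Module.End.mul_apply, Module.End.mul_apply] at h
  rw [← sub_eq_iff_eq_add']
  refine h.trans ?_
  congr 1 <;> split_ifs <;> rfl

lemma re_fischer_matUnit_nonneg (s : S) (i j : Fin (d s))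
    (P : MvPolynomial (∀ s, Fin (d s)) ℂ) :
    0 ≤ (fischer P (matUnit s i j (matUnit s j i P))).re := by
  rw [← fischer_matUnit]
  exact fischer_self_re_nonneg _

lemma IsHighestWeight.antitone {n : ℕ} {w : ∀ s, Fin (d s) → ℝ}
    {P : MvPolynomial (∀ s, Fin (d s)) ℂ} (hP : IsHighestWeight n w P) (s : S) :
    Antitone (w s) := by
  intro i j hij
  rcases hij.eq_or_lt with rfl | hij
  · exact le_rfl
  have h := re_fischer_matUnit_nonneg s i j P
  rw [matUnit_commutator, hP.raise_eq_zero s i j hij, map_zero, zero_add, if_pos rfl, if_pos rfl,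
    hP.weight_eq, hP.weight_eq, ← sub_smul, fischer_smul_right, ← Complex.ofReal_sub,
    Complex.re_ofReal_mul] at h
  exact sub_nonneg.1 (nonneg_of_mul_nonneg_left h (fischer_self_re_pos hP.ne_zero))

lemma casimir_apply (s : S) (P : MvPolynomial (∀ s, Fin (d s)) ℂ) :
    casimir s P = ∑ i, ∑ j, matUnit s i j (matUnit s j i P) := by
  simp [casimir, unitEnd_apply, LinearMap.sum_apply]

lemma energy_apply (x : ∀ s, Fin (d s) → ℝ) (P : MvPolynomial (∀ s, Fin (d s)) ℂ) :
    energy x P = ∑ s, (∑ i, ∑ j, matUnit s i j (matUnit s j i P)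
      - ∑ i, (2 * x s i : ℂ) • matUnit s i i P) := by
  simp [energy, unitEnd_apply, LinearMap.sum_apply, casimir_apply]

lemma energy_isHomogeneous (x : ∀ s, Fin (d s) → ℝ) {n : ℕ}
    {P : MvPolynomial (∀ s, Fin (d s)) ℂ} (hP : P.IsHomogeneous n) :
    (energy x P).IsHomogeneous n := by
  rw [energy_apply]
  refine (homogeneousSubmodule _ _ n).sum_mem fun s _ => Submodule.sub_mem _ ?_ ?_
  · exact Submodule.sum_mem _ fun i _ => Submodule.sum_mem _ fun j _ =>
      matUnit_isHomogeneous s i j (matUnit_isHomogeneous s j i hP)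
  · exact Submodule.sum_mem _ fun i _ => Submodule.smul_mem _ _ (matUnit_isHomogeneous s i i hP)

lemma fischer_energy (x : ∀ s, Fin (d s) → ℝ) (P Q : MvPolynomial (∀ s, Fin (d s)) ℂ) :
    fischer (energy x P) Q = fischer P (energy x Q) := by
  simp only [energy_apply, fischer_sum_left, fischer_sum_right, sub_eq_add_neg, fischer_add_left,
    fischer_add_right, ← neg_smul, ← Finset.sum_neg_distrib, fischer_smul_left,
    fischer_smul_right, fischer_matUnit]
  refine Finset.sum_congr rfl fun s _ => ?_
  congr 1
  refine Finset.sum_congr rfl fun i _ => ?_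
  simp

end

section

open MvPolynomial Function

variable {S : Type*} [Fintype S] [DecidableEq S] {d : S → ℕ}

lemma energy_matUnit (x : ∀ s, Fin (d s) → ℝ) (s : S) (i j : Fin (d s)) {m : ℝ}
    {P : MvPolynomial (∀ s, Fin (d s)) ℂ} (hP : energy x P = (m : ℂ) • P) :
    energy x (matUnit s i j P) = ((m - 2 * (x s i - x s j) : ℝ) : ℂ) • matUnit s i j P := by
  have h := LinearMap.congr_fun (energy_bracket x s i j) P
  rw [LinearMap.sub_apply, Module.End.mul_apply, Module.End.mul_apply, hP, map_smul,
    LinearMap.smul_apply, unitEnd_apply, sub_eq_iff_eq_add] at h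
  rw [h, ← add_smul]
  congr 1
  push_cast
  ring

lemma exists_isHighestWeight_of_energy (x : ∀ s, Fin (d s) → ℝ) (hx : ∀ s, StrictAnti (x s))
    {n : ℕ} {Q : MvPolynomial (∀ s, Fin (d s)) ℂ} (hQ : Q.IsHomogeneous n) (hQ0 : Q ≠ 0) :
    ∃ w P, IsHighestWeight n w P ∧
      (∑ s, ∑ i, (w s i ^ 2 - 2 * x s i * w s i)) * (fischer Q Q).re
        ≤ (fischer Q (energy x Q)).re := by
  have hmap : ∀ P ∈ homogeneousSubmodule (∀ s, Fin (d s)) ℂ n,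
      energy x P ∈ homogeneousSubmodule (∀ s, Fin (d s)) ℂ n :=
    fun P hP => energy_isHomogeneous x hP
  have : FiniteDimensional ℂ (homogeneousSubmodule (∀ s, Fin (d s)) ℂ n) :=
    Module.Finite.iff_fg.2 (homogeneousSubmodule_fg _ _ n)
  have : Nontrivial (homogeneousSubmodule (∀ s, Fin (d s)) ℂ n) :=
    ⟨⟨Q, hQ⟩, 0, fun h => hQ0 (congrArg Subtype.val h)⟩
  obtain ⟨m, ⟨v, hv0, hv⟩, hmin⟩ := exists_lowest_eigenvalue
    (V := homogeneousSubmodule (∀ s, Fin (d s)) ℂ n) (fun P Q => fischer P.1 Q.1)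
    (fun P Q => star_fischer _ _) (fun P P' Q => fischer_add_left _ _ _)
    (fun c P Q => fischer_smul_left _ _ _)
    (fun P hP => fischer_self_re_pos fun h => hP (Subtype.ext h))
    ((energy x).restrict hmap) (fun P Q => fischer_energy _ _ _)
  have hmin' : ∀ P : MvPolynomial (∀ s, Fin (d s)) ℂ, P.IsHomogeneous n →
      m * (fischer P P).re ≤ (fischer P (energy x P)).re := fun P hP => hmin ⟨P, hP⟩
  let W : Submodule ℂ (MvPolynomial (∀ s, Fin (d s)) ℂ) :=
    homogeneousSubmodule _ ℂ n ⊓ LinearMap.ker (energy x - (m : ℂ) • (1 : Module.End ℂ _))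
  have hW : ∀ P, P ∈ W ↔ P.IsHomogeneous n ∧ energy x P = (m : ℂ) • P := by
    intro P
    rw [Submodule.mem_inf, mem_homogeneousSubmodule, LinearMap.mem_ker, LinearMap.sub_apply,
      LinearMap.smul_apply, Module.End.one_apply, sub_eq_zero]
  obtain ⟨P, hPW, hP0, hP⟩ := exists_common_eigenvector
    (fun k : Σ s, Fin (d s) => unitEnd (d := d) k.1 k.2 k.2)
    (by
      rintro ⟨s, i⟩ ⟨t, j⟩
      by_cases hst : s = t
      · subst hst
        rw [commute_iff_eq, ← sub_eq_zero, unitEnd_bracket]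
        by_cases hij : i = j
        · simp [hij]
        · simp [hij, Ne.symm hij]
      · exact unitEnd_commute hst _ _ _ _) Finset.univ W
    (Submodule.finiteDimensional_inf_left _ _)
    ((Submodule.ne_bot_iff _).2 ⟨v, (hW _).2 ⟨v.2, congrArg Subtype.val hv⟩,
      fun h => hv0 (Subtype.ext h)⟩)
    (by
      rintro ⟨s, i⟩ P hP
      rw [hW] at hP ⊢
      refine ⟨matUnit_isHomogeneous s i i hP.1, ?_⟩
      rw [unitEnd_apply, energy_matUnit x s i i hP.2]
      simp)
  have hPW' := (hW P).1 hPW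
  have hraise : ∀ s i j, i < j → matUnit s i j P = 0 := by
    intro s i j hij
    by_contra h0
    have h1 := hmin' _ (matUnit_isHomogeneous s i j hPW'.1)
    rw [energy_matUnit x s i j hPW'.2, fischer_smul_right, Complex.re_ofReal_mul] at h1
    nlinarith [hx s hij, fischer_self_re_pos h0]
  choose c hc using fun k => hP k (Finset.mem_univ k)
  have hreal : ∀ k, ((c k).re : ℂ) = c k := by
    intro k
    have h1 := fischer_matUnit k.1 k.2 k.2 P P
    have h2 : matUnit k.1 k.2 k.2 P = c k • P := hc k
    rw [h2, fischer_smul_left, fischer_smul_right] at h1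
    have h3 : star (c k) = c k := mul_right_cancel₀
      (fun h => (fischer_self_re_pos hP0).ne' (by rw [h, Complex.zero_re])) h1
    exact Complex.conj_eq_iff_re.1 h3
  have hweight : ∀ s i, matUnit s i i P = (((c ⟨s, i⟩).re : ℝ) : ℂ) • P := by
    intro s i
    rw [hreal]
    exact hc ⟨s, i⟩
  refine ⟨fun s i => (c ⟨s, i⟩).re, P, ⟨hPW'.1, hP0, hweight, hraise⟩, ?_⟩
  refine le_trans (mul_le_mul_of_nonneg_right ?_ (fischer_self_re_nonneg Q)) (hmin' Q hQ)
  refine le_of_mul_le_mul_right ?_ (fischer_self_re_pos hP0)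
  have h1 : m * (fischer P P).re = (fischer P (energy x P)).re := by
    rw [hPW'.2, fischer_smul_right, Complex.re_ofReal_mul]
  rw [h1, energy_apply, fischer_sum_right, Complex.re_sum, Finset.sum_mul]
  refine Finset.sum_le_sum fun s _ => ?_
  rw [fischer_sub_right, fischer_sum_right, fischer_sum_right, Complex.sub_re, Complex.re_sum,
    Complex.re_sum, Finset.sum_mul, ← Finset.sum_sub_distrib]
  refine Finset.sum_le_sum fun i _ => ?_
  have h2 : ((c ⟨s, i⟩).re) ^ 2 * (fischer P P).re
      ≤ (fischer P (∑ j, matUnit s i j (matUnit s j i P))).re := by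
    rw [fischer_sum_right, Complex.re_sum]
    refine le_trans (le_of_eq ?_) (Finset.single_le_sum
      (fun j _ => re_fischer_matUnit_nonneg s i j P) (Finset.mem_univ i))
    rw [hweight, Derivation.map_smul, hweight, smul_smul, fischer_smul_right,
      ← Complex.ofReal_mul, Complex.re_ofReal_mul, sq]
  have h3 : (fischer P ((2 * x s i : ℂ) • matUnit s i i P)).re
      = 2 * x s i * (c ⟨s, i⟩).re * (fischer P P).re := by
    rw [hweight, smul_smul, fischer_smul_right]
    have : (2 * x s i * ((c ⟨s, i⟩).re : ℝ) : ℂ) = ((2 * x s i * (c ⟨s, i⟩).re : ℝ) : ℂ) := by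
      push_cast
      ring
    rw [this, Complex.re_ofReal_mul]
  rw [h3, sub_mul]
  exact sub_le_sub_right h2 _

end

section

open MvPolynomial Function Matrix

variable {S : Type*} [Fintype S] [DecidableEq S] {d : S → ℕ}

lemma eval_conjForm {σ : Type*} [Fintype σ] (ψ φ : σ → ℂ) :
    eval ψ (conjForm φ) = star φ ⬝ᵥ ψ := by
  simp [conjForm, dotProduct, smul_eval]

lemma conjForm_isHomogeneous {σ : Type*} [Fintype σ] (φ : σ → ℂ) :
    (conjForm φ).IsHomogeneous 1 :=
  (homogeneousSubmodule _ _ 1).sum_mem fun p _ => Submodule.smul_mem _ _ (isHomogeneous_X ℂ p)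

lemma eval_matUnit (s : S) (i j : Fin (d s)) (P : MvPolynomial (∀ s, Fin (d s)) ℂ)
    (ψ : (∀ s, Fin (d s)) → ℂ) : eval ψ (matUnit s i j P)
      = ∑ q, if q s = j then ψ (update q s i) * eval ψ (pderiv q P) else 0 := by
  rw [matUnit_apply, map_sum]
  refine Finset.sum_congr rfl fun q _ => ?_
  split_ifs <;> simp

lemma eval_matUnit_conjForm (s : S) (i j : Fin (d s)) (ψ φ : (∀ s, Fin (d s)) → ℂ) :
    eval ψ (matUnit s i j (conjForm φ)) = marg s ψ φ i j := by
  rw [marg_eq_sum, conjForm, map_sum, map_sum]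
  refine Finset.sum_congr rfl fun q _ => ?_
  rw [Derivation.map_smul, matUnit_X, smul_eval]
  split_ifs <;> simp [mul_comm]

lemma matUnit_matUnit_conjForm (s : S) (i j : Fin (d s)) (φ : (∀ s, Fin (d s)) → ℂ) :
    matUnit s i j (matUnit s j i (conjForm φ)) = matUnit s i i (conjForm φ) := by
  simp only [conjForm, map_sum, Derivation.map_smul, matUnit_X]
  refine Finset.sum_congr rfl fun q _ => ?_
  split_ifs with h
  · rw [matUnit_X, update_self, if_pos rfl, update_idem]
  · rw [map_zero]

lemma eval_matUnit_conjForm_pow (s : S) (i j : Fin (d s)) {ψ : (∀ s, Fin (d s)) → ℂ}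
    (hψ : star ψ ⬝ᵥ ψ = 1) (n : ℕ) :
    eval ψ (matUnit s i j (conjForm ψ ^ n)) = n * marg s ψ ψ i j := by
  rw [Derivation.leibniz_pow, map_nsmul, smul_eq_mul, map_mul, map_pow, eval_conjForm, hψ, one_pow,
    one_mul, eval_matUnit_conjForm, nsmul_eq_mul]

lemma eval_matUnit_matUnit_conjForm_pow (s : S) (i j : Fin (d s)) {ψ : (∀ s, Fin (d s)) → ℂ}
    (hψ : star ψ ⬝ᵥ ψ = 1) (n : ℕ) :
    eval ψ (matUnit s i j (matUnit s j i (conjForm ψ ^ n)))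
      = n * (marg s ψ ψ i i + (n - 1 : ℕ) * (marg s ψ ψ i j * marg s ψ ψ j i)) := by
  rw [Derivation.leibniz_pow, map_nsmul, smul_eq_mul, Derivation.leibniz,
    matUnit_matUnit_conjForm, map_nsmul, map_add, smul_eq_mul, smul_eq_mul, map_mul, map_mul,
    map_pow, eval_matUnit_conjForm_pow s i j hψ, eval_conjForm, hψ, eval_matUnit_conjForm,
    eval_matUnit_conjForm, nsmul_eq_mul]
  ring

lemma trace_marg (s : S) (φ ψ : (∀ s, Fin (d s)) → ℂ) : trace (marg s ψ φ) = star φ ⬝ᵥ ψ := by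
  rw [← Matrix.one_mul (marg s ψ φ), ← dotProduct_legOp, legOp_one]

lemma trace_rdiag {n : ℕ} (x : Fin n → ℝ) : trace (rdiag x) = ((∑ i, x i : ℝ) : ℂ) := by
  simp [rdiag, trace_diagonal]

/-- The ordered spectra of the marginals of unit vectors. -/
def spectra (d : S → ℕ) : Set (∀ s, Fin (d s) → ℝ) :=
  {lam | (∀ s, Antitone (lam s)) ∧ ∃ ψ : (∀ s, Fin (d s)) → ℂ, star ψ ⬝ᵥ ψ = 1 ∧
    ∀ s, marg s ψ ψ = rdiag (lam s)}

lemma fischer_energy_conjForm_pow (x lam : ∀ s, Fin (d s) → ℝ) {ψ : (∀ s, Fin (d s)) → ℂ}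
    (hψ : star ψ ⬝ᵥ ψ = 1) (hlam : ∀ s, marg s ψ ψ = rdiag (lam s)) (n : ℕ) :
    (fischer (conjForm ψ ^ n) (energy x (conjForm ψ ^ n))).re
      ≤ n.factorial * ∑ s, ((n : ℝ) ^ 2 * ∑ i, lam s i ^ 2 + n * d s
        - 2 * n * ∑ i, x s i * lam s i) := by
  have hn : (conjForm ψ ^ n).IsHomogeneous n := by
    simpa using (conjForm_isHomogeneous ψ).pow n
  have htr : ∀ s, ∑ i, lam s i = 1 := by
    intro s
    have h := trace_marg s ψ ψ
    rw [hψ, hlam, trace_rdiag] at h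
    exact_mod_cast h
  rw [fischer_conjForm_pow ψ n (energy_isHomogeneous x hn), ← Complex.ofReal_natCast,
    Complex.re_ofReal_mul]
  refine mul_le_mul_of_nonneg_left ?_ (Nat.cast_nonneg _)
  rw [energy_apply, map_sum, Complex.re_sum]
  refine Finset.sum_le_sum fun s _ => ?_
  have h1 : ∀ i j, (eval ψ (matUnit s i j (matUnit s j i (conjForm ψ ^ n)))).re
      ≤ n * lam s i + if i = j then (n : ℝ) ^ 2 * lam s i ^ 2 else 0 := by
    intro i j
    rw [eval_matUnit_matUnit_conjForm_pow s i j hψ, hlam, rdiag, diagonal_apply_eq]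
    by_cases hij : i = j
    · subst hij
      have : ((n : ℂ) * ((lam s i : ℂ) + ((n - 1 : ℕ) : ℂ) * (diagonal (fun i => (lam s i : ℂ)) i i
          * diagonal (fun i => (lam s i : ℂ)) i i)))
          = ((n * (lam s i + (n - 1 : ℕ) * (lam s i * lam s i)) : ℝ) : ℂ) := by
        rw [diagonal_apply_eq]
        push_cast
        ring
      rw [this, Complex.ofReal_re, if_pos rfl]
      have h2 : ((n - 1 : ℕ) : ℝ) ≤ n := by exact_mod_cast Nat.sub_le n 1
      have h3 : (n : ℝ) * (lam s i * lam s i) * ((n - 1 : ℕ) : ℝ)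
          ≤ n * (lam s i * lam s i) * n :=
        mul_le_mul_of_nonneg_left h2 (mul_nonneg (Nat.cast_nonneg _) (mul_self_nonneg _))
      nlinarith
    · rw [diagonal_apply_ne _ hij, zero_mul, mul_zero, add_zero, if_neg hij, add_zero,
        ← Complex.ofReal_natCast, ← Complex.ofReal_mul, Complex.ofReal_re]
  have h2 : ∀ i, (eval ψ ((2 * x s i : ℂ) • matUnit s i i (conjForm ψ ^ n))).re
      = 2 * n * (x s i * lam s i) := by
    intro i
    rw [smul_eval, eval_matUnit_conjForm_pow s i i hψ, hlam, rdiag, diagonal_apply_eq]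
    have : (2 * x s i * (n * lam s i) : ℂ) = ((2 * n * (x s i * lam s i) : ℝ) : ℂ) := by
      push_cast
      ring
    rw [this, Complex.ofReal_re]
  simp only [map_sub, map_sum, Complex.sub_re, Complex.re_sum, h2]
  rw [← Finset.mul_sum]
  refine sub_le_sub_right ((Finset.sum_le_sum fun i _ => Finset.sum_le_sum fun j _ =>
    h1 i j).trans (le_of_eq ?_)) _
  simp only [Finset.sum_add_distrib, Finset.sum_const, Finset.card_univ, Fintype.card_fin,
    nsmul_eq_mul, Finset.sum_ite_eq, Finset.mem_univ, if_true, ← Finset.mul_sum, htr]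
  ring

lemma exists_isHighestWeight_near {lam : ∀ s, Fin (d s) → ℝ} (hlam : lam ∈ spectra d)
    {y : ∀ s, Fin (d s) → ℝ} (hy : ∀ s, StrictAnti (y s)) {n : ℕ} (hn : 0 < n) :
    ∃ w P, IsHighestWeight (d := d) n w P ∧ ∑ s, ∑ i, (w s i - n * y s i) ^ 2
      ≤ (n : ℝ) ^ 2 * ∑ s, ∑ i, (lam s i - y s i) ^ 2 + n * ∑ s, (d s : ℝ) := by
  obtain ⟨-, ψ, hψ, hmarg⟩ := hlam
  have hn' : (0 : ℝ) < n := Nat.cast_pos.2 hn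
  have hhom : (conjForm ψ ^ n).IsHomogeneous n := by
    simpa using (conjForm_isHomogeneous ψ).pow n
  have hself : fischer (conjForm ψ ^ n) (conjForm ψ ^ n) = n.factorial := by
    rw [fischer_conjForm_pow ψ n hhom, map_pow, eval_conjForm, hψ, one_pow, mul_one]
  have hne : conjForm ψ ^ n ≠ 0 := by
    intro h
    rw [h, fischer_zero_left] at hself
    exact n.factorial_ne_zero (by exact_mod_cast hself.symm)
  obtain ⟨w, P, hP, hle⟩ := exists_isHighestWeight_of_energy (fun s i => n * y s i)
    (fun s i j hij => mul_lt_mul_of_pos_left (hy s hij) hn') hhom hne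
  refine ⟨w, P, hP, ?_⟩
  have h := hle.trans (fischer_energy_conjForm_pow _ lam hψ hmarg n)
  rw [hself, Complex.natCast_re, mul_comm] at h
  have h := le_of_mul_le_mul_left h (Nat.cast_pos.2 n.factorial_pos)
  have e : (n : ℝ) ^ 2 * ∑ s, ∑ i, (lam s i - y s i) ^ 2 + n * ∑ s, (d s : ℝ)
      - ∑ s, ∑ i, (w s i - n * y s i) ^ 2
      = (∑ s, ((n : ℝ) ^ 2 * ∑ i, lam s i ^ 2 + n * d s - 2 * n * ∑ i, n * y s i * lam s i))
        - ∑ s, ∑ i, (w s i ^ 2 - 2 * (n * y s i) * w s i) := by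
    simp only [Finset.mul_sum, ← Finset.sum_sub_distrib, ← Finset.sum_add_distrib]
    refine Finset.sum_congr rfl fun s _ => ?_
    rw [add_sub_right_comm, ← Finset.sum_sub_distrib, add_sub_right_comm, add_sub_right_comm,
      ← Finset.sum_sub_distrib, ← Finset.sum_sub_distrib]
    congr 1
    refine Finset.sum_congr rfl fun i _ => ?_
    ring
  linarith

end

section

open MvPolynomial Function Matrix

section Polynomial

variable {σ : Type*} [Fintype σ]

lemma star_dotProduct_self_eq_sum_norm (ψ : σ → ℂ) :
    star ψ ⬝ᵥ ψ = ((∑ p, ‖ψ p‖ ^ 2 : ℝ) : ℂ) := by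
  simp [star_dotProduct_self_eq, Complex.normSq_eq_norm_sq]

lemma isCompact_unitSphere : IsCompact {ψ : σ → ℂ | star ψ ⬝ᵥ ψ = 1} := by
  refine Metric.isCompact_of_isClosed_isBounded ?_ ?_
  · refine isClosed_eq ?_ continuous_const
    simp only [dotProduct]
    fun_prop
  · refine (Metric.isBounded_closedBall (x := (0 : σ → ℂ)) (r := 1)).subset fun ψ hψ => ?_
    rw [mem_closedBall_zero_iff, pi_norm_le_iff_of_nonneg zero_le_one]
    intro p
    have h : ∑ p, ‖ψ p‖ ^ 2 = 1 := by
      have := (star_dotProduct_self_eq_sum_norm ψ).symm.trans hψ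
      exact_mod_cast this
    have h1 : ‖ψ p‖ ^ 2 ≤ ∑ p, ‖ψ p‖ ^ 2 :=
      Finset.single_le_sum (f := fun p => ‖ψ p‖ ^ 2) (fun q _ => sq_nonneg _) (Finset.mem_univ p)
    rw [h] at h1
    exact (sq_le_one_iff₀ (norm_nonneg _)).1 h1

lemma eval_smul_of_isHomogeneous {P : MvPolynomial σ ℂ} {n : ℕ} (hP : P.IsHomogeneous n) (c : ℂ)
    (ψ : σ → ℂ) : eval (c • ψ) P = c ^ n * eval ψ P := by
  rw [eval_eq', eval_eq', Finset.mul_sum]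
  refine Finset.sum_congr rfl fun α hα => ?_
  have h : ∑ i, α i = n := by
    rw [← hP (mem_support_iff.1 hα), Finsupp.weight_apply, Finsupp.sum_fintype _ _ (by simp)]
    simp
  simp only [Pi.smul_apply, smul_eq_mul, mul_pow, Finset.prod_mul_distrib, Finset.prod_pow_eq_pow_sum,
    h]
  ring

lemma hasDerivAt_eval (P : MvPolynomial σ ℂ) (φ η : σ → ℂ) :
    HasDerivAt (fun t : ℝ => eval (φ + (t : ℂ) • η) P) (∑ q, η q * eval φ (pderiv q P)) 0 := by
  classical
  induction P using MvPolynomial.induction_on with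
  | C a => simpa using hasDerivAt_const (0 : ℝ) a
  | add P Q hP hQ => simpa [mul_add, Finset.sum_add_distrib] using hP.fun_add hQ
  | mul_X P q hP =>
    have hX : HasDerivAt (fun t : ℝ => φ q + (t : ℂ) * η q) (η q) 0 := by
      simpa using ((hasDerivAt_id (0 : ℝ)).ofReal_comp.mul_const (η q)).const_add (φ q)
    have h := hP.fun_mul hX
    simp only [map_mul, eval_X, Pi.add_apply, Pi.smul_apply, smul_eq_mul]
    refine h.congr_deriv ?_
    symm
    simp only [pderiv_mul, map_add, map_mul, eval_X, mul_add, Finset.sum_add_distrib,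
      Complex.ofReal_zero, zero_mul, add_zero, zero_smul]
    congr 1
    · rw [Finset.sum_mul]
      exact Finset.sum_congr rfl fun p _ => by ring
    · rw [Finset.sum_eq_single q]
      · simp [mul_comm]
      · intro p _ hp
        simp [pderiv_X_of_ne hp.symm]
      · simp

lemma exists_critical_unit {P : MvPolynomial σ ℂ} {n : ℕ} (hP : P.IsHomogeneous n) (hn : 0 < n)
    (hP0 : P ≠ 0) : ∃ φ : σ → ℂ, star φ ⬝ᵥ φ = 1 ∧ eval φ P ≠ 0 ∧
      ∀ q, eval φ (pderiv q P) = n * eval φ P * star (φ q) := by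
  have hscale : ∀ ψ : σ → ℂ, ψ ≠ 0 → ∃ (r : ℝ) (u : σ → ℂ), r ^ 2 = ∑ p, ‖ψ p‖ ^ 2 ∧
      star u ⬝ᵥ u = 1 ∧ ψ = (r : ℂ) • u := by
    intro ψ hψ
    obtain ⟨p, hp⟩ := Function.ne_iff.1 hψ
    have hpos : 0 < ∑ p, ‖ψ p‖ ^ 2 :=
      Finset.sum_pos' (fun q _ => sq_nonneg _) ⟨p, Finset.mem_univ p, by
        have := norm_pos_iff.2 hp
        positivity⟩
    have hr : (√(∑ p, ‖ψ p‖ ^ 2) : ℂ) ≠ 0 := by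
      exact_mod_cast (Real.sqrt_pos.2 hpos).ne'
    refine ⟨√(∑ p, ‖ψ p‖ ^ 2), (√(∑ p, ‖ψ p‖ ^ 2) : ℂ)⁻¹ • ψ, Real.sq_sqrt hpos.le, ?_, ?_⟩
    · rw [star_dotProduct_self_eq_sum_norm]
      simp only [Pi.smul_apply, smul_eq_mul, norm_mul, norm_inv, mul_pow, ← Finset.mul_sum]
      rw [Complex.norm_of_nonneg (Real.sqrt_nonneg _), inv_pow, Real.sq_sqrt hpos.le,
        inv_mul_cancel₀ hpos.ne', Complex.ofReal_one]
    · rw [smul_smul, mul_inv_cancel₀ hr, one_smul]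
  obtain ⟨ψ₀, hψ₀⟩ : ∃ ψ, eval ψ P ≠ 0 := by
    by_contra! h
    exact hP0 (MvPolynomial.funext fun x => by rw [h x, map_zero])
  have hψ₀0 : ψ₀ ≠ 0 := by
    intro h
    apply hψ₀
    have := eval_smul_of_isHomogeneous hP 0 ψ₀
    rwa [zero_smul, zero_pow hn.ne', zero_mul, ← h] at this
  obtain ⟨r₀, u₀, -, hu₀, rfl⟩ := hscale ψ₀ hψ₀0
  rw [eval_smul_of_isHomogeneous hP] at hψ₀
  obtain ⟨φ, hφ, hmax⟩ := isCompact_unitSphere.exists_isMaxOn ⟨u₀, hu₀⟩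
    (continuous_norm.comp (continuous_eval P)).continuousOn
  have hmax' : ∀ u : σ → ℂ, star u ⬝ᵥ u = 1 → ‖eval u P‖ ≤ ‖eval φ P‖ := fun u hu => hmax hu
  have hφP : eval φ P ≠ 0 := by
    intro h
    have := hmax' u₀ hu₀
    rw [h, norm_zero, norm_le_zero_iff] at this
    exact (right_ne_zero_of_mul hψ₀) this
  have hφ1 : ∑ p, ‖φ p‖ ^ 2 = 1 := by
    have := (star_dotProduct_self_eq_sum_norm φ).symm.trans hφ
    exact_mod_cast this
  have hbound : ∀ ψ : σ → ℂ, ‖eval ψ P‖ ^ 2 ≤ ‖eval φ P‖ ^ 2 * (∑ p, ‖ψ p‖ ^ 2) ^ n := by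
    intro ψ
    by_cases hψ : ψ = 0
    · have := eval_smul_of_isHomogeneous hP 0 ψ
      rw [zero_smul, zero_pow hn.ne', zero_mul, ← hψ] at this
      rw [this, norm_zero, zero_pow two_ne_zero]
      positivity
    · obtain ⟨r, u, hr, hu, rfl⟩ := hscale ψ hψ
      rw [← hr, eval_smul_of_isHomogeneous hP, norm_mul, norm_pow, mul_pow, ← pow_mul, mul_comm n 2,
        pow_mul, Complex.norm_real, Real.norm_eq_abs, sq_abs, mul_comm]
      exact mul_le_mul_of_nonneg_right (pow_le_pow_left₀ (norm_nonneg _) (hmax' u hu) 2)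
        (by positivity)
  refine ⟨φ, hφ, hφP, ?_⟩
  have hderiv : ∀ η : σ → ℂ,
      (∑ q, η q * (eval φ (pderiv q P) * star (eval φ P)
        - n * ((‖eval φ P‖ ^ 2 : ℝ) : ℂ) * star (φ q))).re = 0 := by
    intro η
    have h1 := (hasDerivAt_eval P φ η).norm_sq
    have h2 : ∀ p, HasDerivAt (fun t : ℝ => ‖φ p + (t : ℂ) * η p‖ ^ 2)
        (2 * inner ℝ (φ p) (η p)) 0 := by
      intro p
      have hX : HasDerivAt (fun t : ℝ => φ p + (t : ℂ) * η p) (η p) 0 := by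
        simpa using ((hasDerivAt_id (0 : ℝ)).ofReal_comp.mul_const (η p)).const_add (φ p)
      simpa using hX.norm_sq
    have h3 := ((HasDerivAt.fun_sum fun p (_ : p ∈ Finset.univ) => h2 p).fun_pow n).const_mul
      (‖eval φ P‖ ^ 2)
    have h4 := h3.sub h1
    have hmin : IsLocalMin ((fun t : ℝ => ‖eval φ P‖ ^ 2 * (∑ p, ‖φ p + (t : ℂ) * η p‖ ^ 2) ^ n)
        - fun t : ℝ => ‖eval (φ + (t : ℂ) • η) P‖ ^ 2) 0 := by
      refine Filter.Eventually.of_forall fun t => ?_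
      simp only [Pi.sub_apply, Complex.ofReal_zero, zero_mul, add_zero, hφ1, one_pow, mul_one,
        zero_smul, sub_self]
      exact sub_nonneg.2 (hbound (φ + (t : ℂ) • η))
    have h5 := hmin.hasDerivAt_eq_zero h4
    simp only [Complex.ofReal_zero, zero_mul, add_zero, hφ1, one_pow, mul_one, zero_smul,
      Complex.inner, ← Finset.mul_sum] at h5
    have h6 : ∑ q, η q * (eval φ (pderiv q P) * star (eval φ P)
        - n * ((‖eval φ P‖ ^ 2 : ℝ) : ℂ) * star (φ q))
        = (∑ q, η q * eval φ (pderiv q P)) * star (eval φ P)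
          - ((n * ‖eval φ P‖ ^ 2 : ℝ) : ℂ) * ∑ q, η q * star (φ q) := by
      rw [Finset.sum_mul, Finset.mul_sum, ← Finset.sum_sub_distrib]
      refine Finset.sum_congr rfl fun q _ => ?_
      push_cast
      ring
    rw [h6, Complex.sub_re, Complex.re_ofReal_mul, Complex.re_sum]
    simp only [Complex.star_def]
    linarith
  have hcoef : ∀ q, eval φ (pderiv q P) * star (eval φ P)
      - n * ((‖eval φ P‖ ^ 2 : ℝ) : ℂ) * star (φ q) = 0 := by
    classical
    intro q
    set z := eval φ (pderiv q P) * star (eval φ P)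
      - n * ((‖eval φ P‖ ^ 2 : ℝ) : ℂ) * star (φ q) with hz
    have h := hderiv (Pi.single q (star z))
    rw [Finset.sum_eq_single q (fun p _ hp => by rw [Pi.single_eq_of_ne hp, zero_mul])
      (by simp), Pi.single_eq_same, ← hz, Complex.star_def, ← Complex.normSq_eq_conj_mul_self,
      Complex.ofReal_re] at h
    exact Complex.normSq_eq_zero.1 h
  intro q
  have h := hcoef q
  have h2 : ((‖eval φ P‖ ^ 2 : ℝ) : ℂ) = eval φ P * star (eval φ P) := by
    rw [Complex.star_def, Complex.mul_conj, Complex.normSq_eq_norm_sq]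
  rw [h2, sub_eq_zero] at h
  refine mul_right_cancel₀ (star_ne_zero.2 hφP) (h.trans ?_)
  ring

end Polynomial

variable {S : Type*} [Fintype S] [DecidableEq S] {d : S → ℕ}

lemma eval_matUnit_of_critical {P : MvPolynomial (∀ s, Fin (d s)) ℂ} {c : ℂ}
    {φ : (∀ s, Fin (d s)) → ℂ} (h : ∀ q, eval φ (pderiv q P) = c * star (φ q)) (s : S)
    (i j : Fin (d s)) : eval φ (matUnit s i j P) = c * marg s φ φ i j := by
  rw [eval_matUnit, marg_eq_sum, Finset.mul_sum]
  refine Finset.sum_congr rfl fun q _ => ?_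
  split_ifs
  · rw [h]
    ring
  · simp

/-- The normalised weight of a highest weight vector is the spectrum of a state: the state
maximising the modulus of the highest weight vector on the unit sphere. -/
lemma IsHighestWeight.mem_spectra {n : ℕ} {w : ∀ s, Fin (d s) → ℝ}
    {P : MvPolynomial (∀ s, Fin (d s)) ℂ} (hP : IsHighestWeight n w P) (hn : 0 < n) :
    (fun s i => w s i / n) ∈ spectra d := by
  have hn' : (n : ℂ) ≠ 0 := Nat.cast_ne_zero.2 hn.ne'
  obtain ⟨φ, hφ, hφP, hcrit⟩ := exists_critical_unit hP.homogeneous hn hP.ne_zero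
  have h := eval_matUnit_of_critical hcrit
  have hupper : ∀ s i j, i < j → marg s φ φ i j = 0 := by
    intro s i j hij
    have := h s i j
    rw [hP.raise_eq_zero s i j hij, map_zero] at this
    exact (mul_eq_zero.1 this.symm).resolve_left (mul_ne_zero hn' hφP)
  refine ⟨fun s i j hij => div_le_div_of_nonneg_right (hP.antitone s hij) (Nat.cast_nonneg n),
    φ, hφ, fun s => ?_⟩
  ext i j
  rcases lt_trichotomy i j with hij | rfl | hij
  · rw [hupper s i j hij, rdiag, diagonal_apply_ne _ hij.ne]
  · have h1 := h s i i
    rw [hP.weight_eq, smul_eval] at h1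
    rw [rdiag, diagonal_apply_eq, Complex.ofReal_div, Complex.ofReal_natCast, eq_div_iff hn']
    refine mul_right_cancel₀ hφP (h1.trans ?_).symm
    ring
  · have h1 := congrFun (congrFun (conjTranspose_marg s φ φ) i) j
    rw [conjTranspose_apply, hupper s j i hij, star_zero] at h1
    rw [← h1, rdiag, diagonal_apply_ne _ hij.ne']

end

section

open Function Matrix

variable {S : Type*} [Fintype S] [DecidableEq S] {d : S → ℕ}

lemma continuous_marg_self (s : S) :
    Continuous fun ψ : (∀ s, Fin (d s)) → ℂ => marg s ψ ψ := by
  refine continuous_matrix fun i j => ?_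
  simp only [marg, of_apply]
  refine continuous_finsetSum _ fun p _ => ?_
  split_ifs
  · fun_prop
  · exact continuous_const

lemma isClosed_spectra : IsClosed (spectra d) := by
  have hcont : ∀ s i, Continuous fun ψ : (∀ s, Fin (d s)) → ℂ => (marg s ψ ψ i i).re :=
    fun s i => Complex.continuous_re.comp ((continuous_marg_self s).matrix_elem i i)
  let f : ((∀ s, Fin (d s)) → ℂ) → ∀ s, Fin (d s) → ℝ := fun ψ s i => (marg s ψ ψ i i).re
  have hf : Continuous f := continuous_pi fun s => continuous_pi fun i => hcont s i
  have himage : spectra d = f '' ({ψ | star ψ ⬝ᵥ ψ = 1} ∩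
      ({ψ | ∀ s, marg s ψ ψ = rdiag (f ψ s)} ∩ {ψ | ∀ s i j, i ≤ j → f ψ s j ≤ f ψ s i})) := by
    ext lam
    constructor
    · rintro ⟨hlam, ψ, hψ, hmarg⟩
      have hfψ : f ψ = lam := by
        funext s i
        simp [f, hmarg, rdiag]
      exact ⟨ψ, ⟨hψ, fun s => hfψ ▸ hmarg s, fun s i j hij => hfψ ▸ hlam s hij⟩, hfψ⟩
    · rintro ⟨ψ, ⟨hψ, hmarg, hanti⟩, rfl⟩
      exact ⟨fun s i j hij => hanti s i j hij, ψ, hψ, hmarg⟩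
  rw [himage]
  refine ((isCompact_unitSphere.inter_right (IsClosed.inter ?_ ?_)).image hf).isClosed
  · simp only [Set.ofPred_forall]
    refine isClosed_iInter fun s => isClosed_eq (continuous_marg_self s) ?_
    unfold rdiag
    exact Continuous.matrix_diagonal (continuous_pi fun i =>
      Complex.continuous_ofReal.comp (hcont s i))
  · simp only [Set.ofPred_forall]
    exact isClosed_iInter fun s => isClosed_iInter fun i => isClosed_iInter fun j =>
      isClosed_iInter fun _ => isClosed_le (hcont s j) (hcont s i)

lemma exists_isHighestWeight_approx {lam : ∀ s, Fin (d s) → ℝ} (hlam : lam ∈ spectra d)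
    {ε : ℝ} (hε : 0 < ε) : ∃ N : ℕ, ∀ n, N ≤ n → 0 < n →
      ∃ w P, IsHighestWeight (d := d) n w P ∧ ∀ s i, |w s i / n - lam s i| ≤ ε := by
  set M : ℝ := ∑ s, ∑ i : Fin (d s), (i : ℝ) ^ 2 with hM
  set K : ℝ := ∑ s, (d s : ℝ) with hK
  have hM0 : 0 ≤ M := Finset.sum_nonneg fun s _ => Finset.sum_nonneg fun i _ => sq_nonneg _
  set η : ℝ := ε / (4 * (M + 1)) with hη
  have hη0 : 0 < η := by positivity
  have hηM : η * (M + 1) = ε / 4 := by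
    rw [hη]
    field_simp
  obtain ⟨N, hN⟩ := exists_nat_ge (16 * K / ε ^ 2)
  refine ⟨N, fun n hNn hn => ?_⟩
  have hn' : (0 : ℝ) < n := Nat.cast_pos.2 hn
  have hy : ∀ s, StrictAnti fun i : Fin (d s) => lam s i - η * (i : ℝ) := by
    intro s i j hij
    have h1 := hlam.1 s hij.le
    have h2 : (i : ℝ) < j := by exact_mod_cast hij
    have h3 := mul_lt_mul_of_pos_left h2 hη0
    simp only
    linarith
  obtain ⟨w, P, hP, hw⟩ := exists_isHighestWeight_near hlam hy hn
  refine ⟨w, P, hP, fun s i => ?_⟩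
  have h1 : ∑ s, ∑ i : Fin (d s), (lam s i - (lam s i - η * (i : ℝ))) ^ 2 = η ^ 2 * M := by
    simp only [hM, Finset.mul_sum]
    exact Finset.sum_congr rfl fun s _ => Finset.sum_congr rfl fun i _ => by ring
  rw [h1] at hw
  have h2 : (w s i - n * (lam s i - η * (i : ℝ))) ^ 2
      ≤ (n : ℝ) ^ 2 * (η ^ 2 * M) + n * K := by
    refine le_trans ?_ hw
    refine le_trans ?_ (Finset.single_le_sum (f := fun s => ∑ i, (w s i
      - n * (lam s i - η * (i : ℝ))) ^ 2) (fun s _ => Finset.sum_nonneg fun i _ => sq_nonneg _)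
      (Finset.mem_univ s))
    exact Finset.single_le_sum (f := fun i => (w s i - n * (lam s i - η * (i : ℝ))) ^ 2)
      (fun i _ => sq_nonneg _) (Finset.mem_univ i)
  have h3 : n * K ≤ (n : ℝ) ^ 2 * (ε ^ 2 / 16) := by
    have h4 : 16 * K / ε ^ 2 ≤ n := hN.trans (Nat.cast_le.2 hNn)
    rw [div_le_iff₀ (by positivity)] at h4
    nlinarith
  have h5 : η ^ 2 * M ≤ ε ^ 2 / 16 := by
    have h6 : η ^ 2 * M ≤ (η * (M + 1)) ^ 2 := by
      have : 0 ≤ η ^ 2 * (M ^ 2 + M + 1) := by positivity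
      nlinarith
    rw [hηM] at h6
    nlinarith
  have h7 : |w s i - n * (lam s i - η * (i : ℝ))| ≤ n * (ε / 2) := by
    refine abs_le_of_sq_le_sq ?_ (by positivity)
    have h8 := mul_le_mul_of_nonneg_left h5 (sq_nonneg (n : ℝ))
    nlinarith [mul_pos (pow_pos hn' 2) (pow_pos hε 2)]
  have h9 : η * (i : ℝ) ≤ ε / 4 := by
    rw [← hηM]
    refine mul_le_mul_of_nonneg_left ?_ hη0.le
    have h10 : (i : ℝ) ^ 2 ≤ M := by
      refine le_trans ?_ (Finset.single_le_sum (f := fun s => ∑ i : Fin (d s), (i : ℝ) ^ 2)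
        (fun s _ => Finset.sum_nonneg fun i _ => sq_nonneg _) (Finset.mem_univ s))
      exact Finset.single_le_sum (f := fun i : Fin (d s) => (i : ℝ) ^ 2)
        (fun i _ => sq_nonneg _) (Finset.mem_univ i)
    nlinarith [sq_nonneg ((i : ℝ) - 1)]
  have h11 : 0 ≤ η * (i : ℝ) := by positivity
  have h12 : w s i / n - lam s i
      = (w s i - n * (lam s i - η * (i : ℝ))) / n - η * (i : ℝ) := by
    field_simp
    ring
  rw [h12]
  have h13 : |(w s i - n * (lam s i - η * (i : ℝ))) / n| ≤ ε / 2 := by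
    rw [abs_div, abs_of_pos hn', div_le_iff₀ hn', mul_comm (ε / 2)]
    exact h7
  rw [abs_le] at h13 ⊢
  constructor <;> linarith [h13.1, h13.2]

lemma midpoint_mem_spectra {lam mu : ∀ s, Fin (d s) → ℝ} (hlam : lam ∈ spectra d)
    (hmu : mu ∈ spectra d) : (fun s i => (lam s i + mu s i) / 2) ∈ spectra d := by
  rw [← isClosed_spectra.closure_eq, Metric.mem_closure_iff]
  intro ε hε
  obtain ⟨N, hN⟩ := exists_isHighestWeight_approx hlam (half_pos hε)
  obtain ⟨N', hN'⟩ := exists_isHighestWeight_approx hmu (half_pos hε)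
  obtain ⟨w, P, hP, hw⟩ := hN (N + N' + 1) (by omega) (by omega)
  obtain ⟨x, Q, hQ, hx⟩ := hN' (N + N' + 1) (by omega) (by omega)
  set n := N + N' + 1 with hn
  have hn' : (n : ℝ) ≠ 0 := by
    rw [hn]
    positivity
  refine ⟨_, (hP.mul hQ).mem_spectra (by omega), ?_⟩
  refine lt_of_le_of_lt ?_ (half_lt_self hε)
  refine (dist_pi_le_iff (half_pos hε).le).2 fun s => (dist_pi_le_iff (half_pos hε).le).2
    fun i => ?_
  rw [Real.dist_eq, abs_sub_comm]
  have h : (w + x) s i / ((n + n : ℕ) : ℝ) - (lam s i + mu s i) / 2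
      = ((w s i / n - lam s i) + (x s i / n - mu s i)) / 2 := by
    simp only [Pi.add_apply, Nat.cast_add]
    field_simp
    ring
  rw [h]
  have h1 := abs_le.1 (hw s i)
  have h2 := abs_le.1 (hx s i)
  rw [abs_le]
  constructor <;> linarith [h1.1, h1.2, h2.1, h2.2]

end

section

open Function Matrix

variable {S : Type*} [Fintype S] [DecidableEq S] {d : S → ℕ}

lemma mem_cone_of_mem_spectra {lam : ∀ s, Fin (d s) → ℝ} (h : lam ∈ spectra d) : lam ∈ cone d :=
  ⟨h.1, h.2.choose, h.2.choose_spec.2⟩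

lemma pairing_smul (H lam : ∀ s, Fin (d s) → ℝ) (t : ℝ) :
    pairing H (t • lam) = t * pairing H lam := by
  simp only [pairing, Finset.mul_sum, Pi.smul_apply, smul_eq_mul]
  exact Finset.sum_congr rfl fun s _ => Finset.sum_congr rfl fun i _ => by ring

lemma exists_smul_mem_spectra {lam : ∀ s, Fin (d s) → ℝ} (h : lam ∈ cone d) {s : S}
    {i j : Fin (d s)} (hij : lam s j < lam s i) : ∃ t : ℝ, 0 < t ∧ t • lam ∈ spectra d := by
  obtain ⟨hanti, ψ, hψ⟩ := h
  have hψ0 : ψ ≠ 0 := by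
    rintro rfl
    have h1 : ∀ k, lam s k = 0 := by
      intro k
      have h2 := congrFun (congrFun (hψ s) k) k
      rw [rdiag, diagonal_apply_eq] at h2
      have h3 : marg s (0 : (∀ s, Fin (d s)) → ℂ) 0 k k = 0 := by simp [marg]
      rw [h3] at h2
      exact_mod_cast h2.symm
    simp [h1] at hij
  obtain ⟨p, hp⟩ := Function.ne_iff.1 hψ0
  have hpos : 0 < ∑ p, ‖ψ p‖ ^ 2 :=
    Finset.sum_pos' (fun q _ => sq_nonneg _) ⟨p, Finset.mem_univ p, by
      have := norm_pos_iff.2 hp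
      positivity⟩
  set r := ∑ p, ‖ψ p‖ ^ 2 with hr
  have hsq : ((√r : ℝ) : ℂ)⁻¹ * ((√r : ℝ) : ℂ)⁻¹ = ((r⁻¹ : ℝ) : ℂ) := by
    rw [← mul_inv, ← Complex.ofReal_mul, Real.mul_self_sqrt hpos.le, Complex.ofReal_inv]
  have hstar : star (((√r : ℝ) : ℂ)⁻¹) = ((√r : ℝ) : ℂ)⁻¹ := by
    rw [← Complex.ofReal_inv, Complex.star_def, Complex.conj_ofReal]
  refine ⟨r⁻¹, inv_pos.2 hpos, fun t k l hkl => ?_, ((√r : ℝ) : ℂ)⁻¹ • ψ, ?_, fun t => ?_⟩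
  · exact mul_le_mul_of_nonneg_left (hanti t hkl) (inv_pos.2 hpos).le
  · rw [star_smul, hstar, smul_dotProduct, dotProduct_smul, smul_smul, hsq,
      star_dotProduct_self_eq_sum_norm, ← hr, smul_eq_mul, ← Complex.ofReal_mul,
      inv_mul_cancel₀ hpos.ne', Complex.ofReal_one]
  · rw [marg_smul_left, marg_smul_right, hstar, smul_smul, hsq, hψ]
    ext k l
    by_cases hkl : k = l
    · subst hkl
      simp [rdiag]
    · simp [rdiag, diagonal_apply_ne _ hkl]

/-- A family of antitone spectra closed under midpoints that leaves every wall contains a point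
off all the walls. -/
lemma exists_strictAnti_of_midpoint (G : Set (∀ s, Fin (d s) → ℝ)) (hne : G.Nonempty)
    (hanti : ∀ lam ∈ G, ∀ s, Antitone (lam s))
    (hmid : ∀ lam ∈ G, ∀ mu ∈ G, (fun s i => (lam s i + mu s i) / 2) ∈ G)
    (hwall : ∀ s i j, i < j → ∃ lam ∈ G, lam s j < lam s i) :
    ∃ lam ∈ G, ∀ s, StrictAnti (lam s) := by
  classical
  have key : ∀ T : Finset (Σ s, Fin (d s) × Fin (d s)),
      ∃ lam ∈ G, ∀ k ∈ T, k.2.1 < k.2.2 → lam k.1 k.2.2 < lam k.1 k.2.1 := by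
    intro T
    induction T using Finset.induction_on with
    | empty =>
      obtain ⟨lam, h⟩ := hne
      exact ⟨lam, h, by simp⟩
    | insert k T _ ih =>
      obtain ⟨lam, hlam, h⟩ := ih
      by_cases hk : k.2.1 < k.2.2
      · obtain ⟨mu, hmu, hlt⟩ := hwall k.1 _ _ hk
        refine ⟨_, hmid lam hlam mu hmu, fun l hl hll => ?_⟩
        have h1 := hanti lam hlam l.1 hll.le
        have h2 := hanti mu hmu l.1 hll.le
        rcases Finset.mem_insert.1 hl with rfl | hl
        · linarith
        · have := h l hl hll
          linarith
      · refine ⟨lam, hlam, fun l hl hll => ?_⟩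
        rcases Finset.mem_insert.1 hl with rfl | hl
        · exact absurd hll hk
        · exact h l hl hll
  obtain ⟨lam, hlam, h⟩ := key Finset.univ
  exact ⟨lam, hlam, fun s i j hij => h ⟨s, i, j⟩ (Finset.mem_univ _) hij⟩

lemma exists_mem_cone_lt {s : S} (g : Fin (d s) → ∀ t, Fin (d t)) (hgs : ∀ m, g m s = m)
    (hg : ∀ m m', (∀ t, t ≠ s → g m t = g m' t) → m = m') {i j : Fin (d s)} (hij : i < j) :
    ∃ lam ∈ cone d, lam s j < lam s i := by
  set ψ : (∀ s, Fin (d s)) → ℂ := fun p => if p s ≤ i ∧ p = g (p s) then 1 else 0 with hψ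
  have hmarg : marg s ψ ψ = rdiag fun m => if m ≤ i then 1 else 0 := by
    ext k l
    rw [marg, of_apply, Finset.sum_eq_single (g k)]
    · rw [if_pos (hgs k)]
      by_cases hkl : k = l
      · subst hkl
        have hupd : update (g k) s k = g k := by
          rw [update_eq_iff]
          exact ⟨(hgs k).symm, fun _ _ => rfl⟩
        rw [hupd, rdiag, diagonal_apply_eq]
        simp only [hψ, hgs, and_true]
        split_ifs <;> simp
      · have h1 : update (g k) s l ≠ g l := by
          intro h
          refine hkl (hg k l fun t ht => ?_)
          rw [← h, update_of_ne ht]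
        rw [rdiag, diagonal_apply_ne _ hkl]
        simp [hψ, h1]
    · intro p _ hp
      split_ifs with hpk
      · have : ψ p = 0 := by
          simp only [hψ]
          rw [if_neg]
          rintro ⟨-, h⟩
          exact hp (by rw [← hpk]; exact h)
        rw [this, zero_mul]
      · rfl
    · simp
  choose x hx U hU hUx using fun t => exists_sorted_unitary (marg_self_isHermitian t ψ)
  obtain ⟨ψ', hψ'⟩ := exists_rotate (fun t => if t = s then 1 else U t)
    (fun t => by split_ifs <;> simp [hU]) ψ
  refine ⟨update x s fun m => if m ≤ i then 1 else 0, ⟨fun t => ?_, ψ', fun t => ?_⟩, ?_⟩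
  · by_cases ht : t = s
    · subst ht
      rw [update_self]
      intro k l hkl
      dsimp only
      split_ifs with h1 h2
      · exact le_rfl
      · exact absurd (hkl.trans h1) h2
      · exact zero_le_one
      · exact le_rfl
    · rw [update_of_ne ht]
      exact hx t
  · rw [hψ']
    by_cases ht : t = s
    · subst ht
      simp [hmarg]
    · rw [if_neg ht, hUx, update_of_ne ht]
  · rw [update_self]
    simp [hij.not_ge]

end

section

open Function Matrix

lemma rdiag_isHermitian {n : ℕ} (x : Fin n → ℝ) : (rdiag x).IsHermitian := by
  unfold rdiag
  exact isHermitian_diagonal_of_self_adjoint _ (funext fun i => Complex.conj_ofReal _)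

lemma isSpecDown_rdiag {n : ℕ} {x : Fin n → ℝ} (hx : Antitone x) : IsSpecDown (rdiag x) x := by
  have h := rdiag_isHermitian x
  set τ := Tuple.sort fun i => -h.eigenvalues i with hτ
  refine ⟨hx, h, τ, ?_⟩
  have hanti : Antitone (h.eigenvalues ∘ τ) := fun i j hij => by
    simpa using Tuple.monotone_sort (fun i => -h.eigenvalues i) hij
  have hroots : Multiset.map x Finset.univ.val = Multiset.map h.eigenvalues Finset.univ.val := by
    have h1 := h.roots_charpoly_eq_eigenvalues
    rw [show (rdiag x).charpoly = _ from charpoly_diagonal _, Polynomial.roots_prod _ _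
      (Finset.prod_ne_zero_iff.2 fun i _ => Polynomial.X_sub_C_ne_zero _)] at h1
    simp only [Polynomial.roots_X_sub_C, Multiset.bind_singleton] at h1
    have h2 := congrArg (Multiset.map Complex.re) h1
    simpa [Multiset.map_map, Function.comp_def] using h2
  have hperm : (List.ofFn x).Perm (List.ofFn (h.eigenvalues ∘ τ)) := by
    refine List.Perm.trans ?_ (τ.ofFn_comp_perm h.eigenvalues).symm
    rw [← Multiset.coe_eq_coe]
    simpa [Fin.univ_val_map] using hroots
  exact List.ofFn_injective (hperm.eq_of_sortedGE hx.sortedGE_ofFn hanti.sortedGE_ofFn)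

/-- The dimensions of the three legs. -/
def legDim (a b c : ℕ) : Fin 3 → ℕ
  | 0 => a
  | 1 => b
  | 2 => c

/-- A dependent triple, indexed by `Fin 3`. -/
def triple {β : Fin 3 → Type*} (x : β 0) (y : β 1) (z : β 2) : ∀ s, β s
  | 0 => x
  | 1 => y
  | 2 => z

variable {a b c : ℕ}

/-- Triples of indices as multi-indices. -/
def tripleEquiv (a b c : ℕ) : Fin a × Fin b × Fin c ≃ ∀ s, Fin (legDim a b c s) where
  toFun p := triple (β := fun s => Fin (legDim a b c s)) p.1 p.2.1 p.2.2
  invFun q := (q 0, q 1, q 2)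
  left_inv _ := rfl
  right_inv q := by
    funext s
    fin_cases s <;> rfl

/-- Triples of real vectors as families of vectors. -/
def tup (x : Fin a → ℝ) (y : Fin b → ℝ) (z : Fin c → ℝ) : ∀ s, Fin (legDim a b c s) → ℝ :=
  triple (β := fun s => Fin (legDim a b c s) → ℝ) x y z

/-- A tripartite vector as a multipartite one. -/
def lift3 (ψ : Fin a × Fin b × Fin c → ℂ) : (∀ s, Fin (legDim a b c s)) → ℂ :=
  fun q => ψ (q 0, q 1, q 2)

lemma marg_lift3_zero (ψ : Fin a × Fin b × Fin c → ℂ) :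
    marg 0 (lift3 ψ) (lift3 ψ) = rhoA ψ := by
  ext (i : Fin a) (j : Fin a)
  refine Eq.trans ((tripleEquiv a b c).sum_comp _).symm ?_
  change (∑ p : Fin a × Fin b × Fin c, if p.1 = i then ψ p * star (ψ (j, p.2.1, p.2.2)) else 0) = _
  simp_rw [Fintype.sum_prod_type, rhoA, of_apply]
  rw [Finset.sum_eq_single i]
  · simp
  · intro k _ hk
    simp [hk]
  · simp

lemma marg_lift3_one (ψ : Fin a × Fin b × Fin c → ℂ) :
    marg 1 (lift3 ψ) (lift3 ψ) = rhoB ψ := by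
  ext (i : Fin b) (j : Fin b)
  refine Eq.trans ((tripleEquiv a b c).sum_comp _).symm ?_
  change (∑ p : Fin a × Fin b × Fin c, if p.2.1 = i then ψ p * star (ψ (p.1, j, p.2.2)) else 0) = _
  simp_rw [Fintype.sum_prod_type, rhoB, of_apply]
  refine Finset.sum_congr rfl fun x _ => ?_
  rw [Finset.sum_eq_single i]
  · simp
  · intro k _ hk
    simp [hk]
  · simp

lemma marg_lift3_two (ψ : Fin a × Fin b × Fin c → ℂ) :
    marg 2 (lift3 ψ) (lift3 ψ) = rhoC ψ := by
  ext (i : Fin c) (j : Fin c)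
  refine Eq.trans ((tripleEquiv a b c).sum_comp _).symm ?_
  change (∑ p : Fin a × Fin b × Fin c, if p.2.2 = i then ψ p * star (ψ (p.1, p.2.1, j)) else 0) = _
  simp_rw [Fintype.sum_prod_type, rhoC, of_apply]
  refine Finset.sum_congr rfl fun x _ => Finset.sum_congr rfl fun y _ => ?_
  rw [Finset.sum_eq_single i]
  · simp
  · intro k _ hk
    simp [hk]
  · simp

lemma lift3_surjective (φ : (∀ s, Fin (legDim a b c s)) → ℂ) :
    ∃ ψ : Fin a × Fin b × Fin c → ℂ, lift3 ψ = φ :=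
  ⟨φ ∘ tripleEquiv a b c, funext fun q => congrArg φ ((tripleEquiv a b c).right_inv q)⟩

lemma mem_cone_iff_isSpecDown {S : Type*} [Fintype S] [DecidableEq S] {d : S → ℕ}
    (lam : ∀ s, Fin (d s) → ℝ) :
    lam ∈ cone d ↔ ∃ ψ, ∀ s, IsSpecDown (marg s ψ ψ) (lam s) := by
  constructor
  · rintro ⟨hanti, ψ, hψ⟩
    refine ⟨ψ, fun s => ?_⟩
    rw [hψ s]
    exact isSpecDown_rdiag (hanti s)
  · rintro ⟨ψ, hψ⟩
    choose hanti hρ σ hσ using hψ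
    choose U hU hdiag using fun s => exists_unitary_of_eigenvalues (hρ s) (σ s)
    obtain ⟨φ, hφ⟩ := exists_rotate U hU ψ
    exact ⟨hanti, φ, fun s => by rw [hφ, hdiag, hσ]⟩

lemma mem_kronCone_iff (x : Fin a → ℝ) (y : Fin b → ℝ) (z : Fin c → ℝ) :
    (x, y, z) ∈ KronCone a b c ↔ tup x y z ∈ cone (legDim a b c) := by
  have key : ∀ ψ : Fin a × Fin b × Fin c → ℂ,
      (IsSpecDown (rhoA ψ) x ∧ IsSpecDown (rhoB ψ) y ∧ IsSpecDown (rhoC ψ) z) ↔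
      ∀ s, IsSpecDown (marg s (lift3 ψ) (lift3 ψ)) (tup x y z s) := by
    intro ψ
    rw [← marg_lift3_zero, ← marg_lift3_one, ← marg_lift3_two, Fin.forall_fin_succ,
      Fin.forall_fin_succ, Fin.forall_fin_succ]
    exact and_congr Iff.rfl (and_congr Iff.rfl ⟨fun h => ⟨h, finZeroElim⟩, fun h => h.1⟩)
  rw [mem_cone_iff_isSpecDown]
  constructor
  · rintro ⟨ψ, hψ⟩
    exact ⟨lift3 ψ, (key ψ).1 hψ⟩
  · rintro ⟨φ, hφ⟩
    obtain ⟨ψ, rfl⟩ := lift3_surjective φ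
    exact ⟨ψ, (key ψ).2 hφ⟩

lemma exists_eq_tup (lam : ∀ s, Fin (legDim a b c s) → ℝ) :
    ∃ x y z, lam = tup (a := a) (b := b) (c := c) x y z :=
  ⟨lam 0, lam 1, lam 2, by
    funext s
    fin_cases s <;> rfl⟩

lemma pairing_tup (HA : Fin a → ℝ) (HB : Fin b → ℝ) (HC : Fin c → ℝ) (z : ℝ)
    (lam : (Fin a → ℝ) × (Fin b → ℝ) × (Fin c → ℝ)) :
    pairing (tup (fun i => HA i + z) HB HC) (tup lam.1 lam.2.1 lam.2.2)
      = wtPair HA HB HC z lam := by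
  have : pairing (tup (fun i => HA i + z) HB HC) (tup lam.1 lam.2.1 lam.2.2)
      = (∑ i, (HA i + z) * lam.1 i) + (∑ i, HB i * lam.2.1 i) + ∑ i, HC i * lam.2.2 i := by
    rw [pairing, Fin.sum_univ_three]
    rfl
  rw [this, wtPair]
  simp only [add_mul, Finset.sum_add_distrib, Finset.mul_sum]
  ring

lemma weight_tup (HA : Fin a → ℝ) (HB : Fin b → ℝ) (HC : Fin c → ℝ) (z : ℝ)
    (p : Fin a × Fin b × Fin c) :
    weight (tup (fun i => HA i + z) HB HC) (tripleEquiv a b c p)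
      = HA p.1 + HB p.2.1 + HC p.2.2 + z := by
  rw [weight, Fin.sum_univ_three]
  change HA p.1 + z + HB p.2.1 + HC p.2.2 = _
  ring

lemma sum_eq_of_mem_cone {S : Type*} [Fintype S] [DecidableEq S] {d : S → ℕ}
    {lam : ∀ s, Fin (d s) → ℝ} (h : lam ∈ cone d) (s t : S) :
    ∑ i, lam s i = ∑ i, lam t i := by
  obtain ⟨-, ψ, hψ⟩ := h
  have h1 := trace_marg s ψ ψ
  have h2 := trace_marg t ψ ψ
  rw [hψ, trace_rdiag] at h1 h2
  exact_mod_cast h1.trans h2.symm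

end

section

open Function Matrix

section general

variable {S : Type*} [Fintype S] [DecidableEq S] {d : S → ℕ}

/-- The pairing as a linear map into the dual space. -/
def pairingMap (d : S → ℕ) :
    (∀ s, Fin (d s) → ℝ) →ₗ[ℝ] Module.Dual ℝ (∀ s, Fin (d s) → ℝ) :=
  LinearMap.mk₂ ℝ pairing
    (fun H K v => by simp [pairing, add_mul, Finset.sum_add_distrib])
    (fun r H v => by simp [pairing, Finset.mul_sum, mul_assoc])
    (fun H v w => by simp [pairing, mul_add, Finset.sum_add_distrib])
    (fun r H v => pairing_smul H v r)

lemma pairingMap_apply (H v : ∀ s, Fin (d s) → ℝ) : pairingMap d H v = pairing H v := rfl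

lemma pairing_single_sub_single (s : S) (i j : Fin (d s)) (v : ∀ s, Fin (d s) → ℝ) :
    pairing (Pi.single s (Pi.single i 1 - Pi.single j 1)) v = v s i - v s j := by
  rw [pairing, Finset.sum_eq_single s]
  · simp [sub_mul, Finset.sum_sub_distrib, Pi.single_apply]
  · intro t _ ht
    simp [Pi.single_eq_of_ne ht]
  · simp

lemma pairingMap_injective : Injective (pairingMap d) := by
  rw [injective_iff_map_eq_zero]
  intro H hH
  funext s i
  have h := LinearMap.congr_fun hH (Pi.single s (Pi.single i 1))
  rw [pairingMap_apply, pairing, Finset.sum_eq_single s] at h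
  · simpa [Pi.single_apply] using h
  · intro t _ ht
    simp [Pi.single_eq_of_ne ht]
  · simp

lemma not_linearIndependent_of_pairing_eq_zero (D : Submodule ℝ (∀ s, Fin (d s) → ℝ)) {n : ℕ}
    (hD : ∑ s, d s < Module.finrank ℝ D + n) (K : Fin n → ∀ s, Fin (d s) → ℝ)
    (hK : ∀ k, ∀ v ∈ D, pairing (K k) v = 0) : ¬ LinearIndependent ℝ K := by
  intro hli
  have h1 : LinearIndependent ℝ (pairingMap d ∘ K) :=
    hli.map' (pairingMap d) (LinearMap.ker_eq_bot.2 pairingMap_injective)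
  let f : Fin n → D.dualAnnihilator := fun k =>
    ⟨pairingMap d (K k), (Submodule.mem_dualAnnihilator _).2 fun v hv => hK k v hv⟩
  have h2 : LinearIndependent ℝ f :=
    LinearIndependent.of_comp D.dualAnnihilator.subtype h1
  have h3 := h2.fintype_card_le_finrank
  have h4 := Subspace.finrank_add_finrank_dualAnnihilator_eq D
  have h5 : Module.finrank ℝ (∀ s, Fin (d s) → ℝ) = ∑ s, d s := by
    rw [Module.finrank_pi_fintype]
    simp
  rw [Fintype.card_fin] at h3
  omega

end general

variable {a b c : ℕ}

lemma exists_mem_cone_legDim_lt (hab : a ≤ b) (hbc : b ≤ c) (hcab : c ≤ a * b) (ha : 0 < a) :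
    ∀ (s : Fin 3) (i j : Fin (legDim a b c s)), i < j →
      ∃ lam ∈ cone (legDim a b c), lam s j < lam s i
  | 0, i, j, hij => by
    refine exists_mem_cone_lt (s := 0) (d := legDim a b c) (fun m : Fin a => tripleEquiv a b c
      (m, Fin.castLE hab m, ⟨0, by omega⟩)) (fun m => rfl) (fun m m' h => ?_) hij
    exact Fin.castLE_injective hab (h 1 (by decide))
  | 1, i, j, hij => by
    refine exists_mem_cone_lt (s := 1) (d := legDim a b c) (fun m : Fin b => tripleEquiv a b c
      (⟨0, ha⟩, m, Fin.castLE hbc m)) (fun m => rfl) (fun m m' h => ?_) hij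
    exact Fin.castLE_injective hbc (h 2 (by decide))
  | 2, i, j, hij => by
    refine exists_mem_cone_lt (s := 2) (d := legDim a b c) (fun m : Fin c => tripleEquiv a b c
      ((finProdFinEquiv.symm (Fin.castLE hcab m)).1,
        (finProdFinEquiv.symm (Fin.castLE hcab m)).2, m)) (fun m => rfl) (fun m m' h => ?_) hij
    have h0 : (finProdFinEquiv.symm (Fin.castLE hcab m)).1
      = (finProdFinEquiv.symm (Fin.castLE hcab m')).1 := h 0 (by decide)
    have h1 : (finProdFinEquiv.symm (Fin.castLE hcab m)).2
      = (finProdFinEquiv.symm (Fin.castLE hcab m')).2 := h 1 (by decide)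
    exact Fin.castLE_injective hcab (finProdFinEquiv.symm.injective (Prod.ext h0 h1))

/-- The linear equivalence underlying `tup`. -/
def tupEquiv (a b c : ℕ) : ((Fin a → ℝ) × (Fin b → ℝ) × (Fin c → ℝ)) ≃ₗ[ℝ]
    (∀ s, Fin (legDim a b c s) → ℝ) where
  toFun lam := tup lam.1 lam.2.1 lam.2.2
  invFun v := (v 0, v 1, v 2)
  left_inv _ := rfl
  right_inv v := by
    funext s
    fin_cases s <;> rfl
  map_add' v w := by
    funext s
    fin_cases s <;> rfl
  map_smul' r v := by
    funext s
    fin_cases s <;> rfl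

lemma pairing_leg_const (u : Fin 3 → ℝ) (v : ∀ s, Fin (legDim a b c s) → ℝ) :
    pairing (fun s _ => u s) v
      = u 0 * ∑ i, v 0 i + u 1 * ∑ i, v 1 i + u 2 * ∑ i, v 2 i := by
  simp [pairing, Fin.sum_univ_three, Finset.mul_sum]

/-- If all coordinates `i`, `j` on leg `s` agree on the face, the normal is proportional to
a wall of the Weyl chamber. -/
lemma eq_smul_of_face_subset_wall (ha : 0 < a) (hab : a ≤ b) (hbc : b ≤ c)
    {HA : Fin a → ℝ} {HB : Fin b → ℝ} {HC : Fin c → ℝ} {z : ℝ}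
    (htr : Traceless HA HB HC)
    (hrank : Module.finrank ℝ
      (affineSpan ℝ {lam ∈ KronCone a b c | wtPair HA HB HC z lam = 0}).direction = a + b + c - 3)
    (s : Fin 3) {i j : Fin (legDim a b c s)} (hij : i < j)
    (hwall : ∀ lam ∈ KronCone a b c, wtPair HA HB HC z lam = 0 →
      tup lam.1 lam.2.1 lam.2.2 s i = tup lam.1 lam.2.1 lam.2.2 s j) :
    z = 0 ∧ ∃ r : ℝ, tup HA HB HC = r • Pi.single s (Pi.single i 1 - Pi.single j 1) := by
  set H := tup (fun i => HA i + z) HB HC with hH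
  set w : ∀ s, Fin (legDim a b c s) → ℝ := Pi.single s (Pi.single i 1 - Pi.single j 1) with hw
  let K : Fin 4 → ∀ s, Fin (legDim a b c s) → ℝ :=
    ![fun t _ => (![1, -1, 0] : Fin 3 → ℝ) t, fun t _ => (![1, 0, -1] : Fin 3 → ℝ) t, H, w]
  set F := {lam ∈ KronCone a b c | wtPair HA HB HC z lam = 0} with hF
  have hKF : ∀ k, ∀ lam ∈ F, pairing (K k) (tupEquiv a b c lam) = 0 := by
    rintro k lam ⟨hlam, h0⟩
    have hsum := fun t => sum_eq_of_mem_cone ((mem_kronCone_iff _ _ _).1 hlam) 0 t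
    fin_cases k
    · refine (pairing_leg_const _ _).trans ?_
      change (1 : ℝ) * ∑ i, tup lam.1 lam.2.1 lam.2.2 0 i
        + (-1) * ∑ i, tup lam.1 lam.2.1 lam.2.2 1 i
        + (0) * ∑ i, tup lam.1 lam.2.1 lam.2.2 2 i = 0
      have := hsum 1
      linarith
    · refine (pairing_leg_const _ _).trans ?_
      change (1 : ℝ) * ∑ i, tup lam.1 lam.2.1 lam.2.2 0 i
        + (0) * ∑ i, tup lam.1 lam.2.1 lam.2.2 1 i
        + (-1) * ∑ i, tup lam.1 lam.2.1 lam.2.2 2 i = 0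
      have := hsum 2
      linarith
    · exact (pairing_tup HA HB HC z lam).trans h0
    · refine (pairing_single_sub_single s i j _).trans ?_
      exact sub_eq_zero.2 (hwall lam hlam h0)
  have hdep : ¬ LinearIndependent ℝ K := by
    refine not_linearIndependent_of_pairing_eq_zero
      ((affineSpan ℝ F).direction.map (tupEquiv a b c).toLinearMap) ?_ K ?_
    · have h1 := LinearEquiv.finrank_map_eq (tupEquiv a b c) (affineSpan ℝ F).direction
      rw [hrank] at h1
      have h2 : ∑ t, legDim a b c t = a + b + c := Fin.sum_univ_three _
      have h3 : a + b + c < a + b + c - 3 + 4 := by omega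
      exact lt_of_eq_of_lt h2 (lt_of_lt_of_eq h3 (congrArg (· + 4) h1.symm))
    · rintro k _ ⟨v, hv, rfl⟩
      rw [direction_affineSpan, vectorSpan_def] at hv
      refine (Submodule.span_le (p := LinearMap.ker
        ((pairingMap _ (K k)).comp (tupEquiv a b c).toLinearMap))).2 ?_ hv
      rintro _ ⟨x, hx, y, hy, rfl⟩
      have hx' := hKF k x hx
      have hy' := hKF k y hy
      rw [← pairingMap_apply] at hx' hy'
      rw [SetLike.mem_coe, LinearMap.mem_ker]
      refine (map_sub _ x y).trans ?_
      exact (congrArg₂ (· - ·) hx' hy').trans (sub_zero 0)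
  obtain ⟨g, hg, k, hk⟩ := Fintype.not_linearIndependent_iff.1 hdep
  have hgt : ∀ t m, g 0 * (![1, -1, 0] : Fin 3 → ℝ) t + g 1 * (![1, 0, -1] : Fin 3 → ℝ) t
      + g 2 * H t m + g 3 * w t m = 0 := by
    intro t m
    have h := congrFun (congrFun hg t) m
    rw [Fin.sum_univ_four] at h
    exact h
  have hwsum : ∀ t, ∑ m, w t m = 0 := by
    intro t
    rcases eq_or_ne t s with rfl | hts
    · simp [hw]
    · simp [hw, Pi.single_eq_of_ne hts]
  have hgs : ∀ t, (legDim a b c t : ℝ) * (g 0 * (![1, -1, 0] : Fin 3 → ℝ) t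
      + g 1 * (![1, 0, -1] : Fin 3 → ℝ) t) + g 2 * ∑ m, H t m = 0 := by
    intro t
    have h := Finset.sum_congr rfl fun m (_ : m ∈ Finset.univ) => hgt t m
    rw [Finset.sum_add_distrib, Finset.sum_add_distrib, ← Finset.mul_sum, ← Finset.mul_sum,
      hwsum] at h
    simpa [mul_add] using h
  have hH0 : ∑ m, H 0 m = a * z := by
    change ∑ m, (HA m + z) = _
    rw [Finset.sum_add_distrib, htr.1]
    simp
  have hH1 : ∑ m, H 1 m = 0 := htr.2.1
  have hH2 : ∑ m, H 2 m = 0 := htr.2.2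
  have ha' : (a : ℝ) ≠ 0 := by positivity
  have hb' : (b : ℝ) ≠ 0 := by
    have : 0 < b := by omega
    positivity
  have hc' : (c : ℝ) ≠ 0 := by
    have : 0 < c := by omega
    positivity
  have hg0 : g 0 = 0 := by
    have h := hgs 1
    rw [hH1] at h
    simpa [legDim, hb'] using h
  have hg1 : g 1 = 0 := by
    have h := hgs 2
    rw [hH2] at h
    simpa [legDim, hc'] using h
  have hgz : g 2 = 0 ∨ z = 0 := by
    have h := hgs 0
    rw [hH0, hg0, hg1] at h
    simpa [ha'] using h
  simp only [hg0, hg1, zero_mul, zero_add] at hgt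
  have hg2 : g 2 ≠ 0 := by
    intro h2
    have h3 : g 3 = 0 := by
      have h := hgt s i
      simpa [h2, hw, Pi.single_apply, hij.ne] using h
    fin_cases k
    exacts [hk hg0, hk hg1, hk h2, hk h3]
  have hz : z = 0 := hgz.resolve_left hg2
  refine ⟨hz, -(g 3 / g 2), ?_⟩
  have : H = tup HA HB HC := by
    rw [hH, hz]
    simp
  rw [← this]
  funext t m
  have h := hgt t m
  simp only [Pi.smul_apply, smul_eq_mul]
  field_simp
  linarith

end

section

open Function Matrix

variable {a b c : ℕ}

lemma smul_single_same {S : Type*} [DecidableEq S] {d : S → ℕ} (r : ℝ) (s : S)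
    (v : Fin (d s) → ℝ) : (r • (Pi.single s v : ∀ s, Fin (d s) → ℝ)) s = r • v := by
  simp

lemma isTrivialNormal_of_tup_eq {HA : Fin a → ℝ} {HB : Fin b → ℝ} {HC : Fin c → ℝ} {r : ℝ}
    (hr : 0 < r) : ∀ (s : Fin 3) (i j : Fin (legDim a b c s)), i < j →
      tup HA HB HC = r • Pi.single s (Pi.single i 1 - Pi.single j 1) →
      IsTrivialNormal HA HB HC 0
  | 0, i, j, hij, h => by
    refine ⟨r, hr, Or.inl ⟨i, j, hij, ?_, ?_, ?_, rfl⟩⟩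
    · exact (congrFun h 0).trans (smul_single_same (d := legDim a b c) r 0 _)
    · exact (congrFun h 1).trans (smul_zero r)
    · exact (congrFun h 2).trans (smul_zero r)
  | 1, i, j, hij, h => by
    refine ⟨r, hr, Or.inr (Or.inl ⟨i, j, hij, ?_, ?_, ?_, rfl⟩)⟩
    · exact (congrFun h 1).trans (smul_single_same (d := legDim a b c) r 1 _)
    · exact (congrFun h 0).trans (smul_zero r)
    · exact (congrFun h 2).trans (smul_zero r)
  | 2, i, j, hij, h => by
    refine ⟨r, hr, Or.inr (Or.inr ⟨i, j, hij, ?_, ?_, ?_, rfl⟩)⟩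
    · exact (congrFun h 2).trans (smul_single_same (d := legDim a b c) r 2 _)
    · exact (congrFun h 0).trans (smul_zero r)
    · exact (congrFun h 1).trans (smul_zero r)

lemma pairing_tup_nonneg {HA : Fin a → ℝ} {HB : Fin b → ℝ} {HC : Fin c → ℝ} {z : ℝ}
    (h : ∀ lam ∈ KronCone a b c, 0 ≤ wtPair HA HB HC z lam) {mu : ∀ s, Fin (legDim a b c s) → ℝ}
    (hmu : mu ∈ cone (legDim a b c)) : 0 ≤ pairing (tup (fun i => HA i + z) HB HC) mu := by
  obtain ⟨x, y, w, rfl⟩ := exists_eq_tup mu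
  exact (h _ ((mem_kronCone_iff x y w).2 hmu)).trans_eq (pairing_tup HA HB HC z (x, y, w)).symm

lemma exists_mem_face_lt (ha : 0 < a) (hab : a ≤ b) (hbc : b ≤ c) (hcab : c ≤ a * b)
    {HA : Fin a → ℝ} {HB : Fin b → ℝ} {HC : Fin c → ℝ} {z : ℝ}
    (hfacet : IsFacetNormal a b c HA HB HC z) (hnt : ¬ IsTrivialNormal HA HB HC z)
    (s : Fin 3) {i j : Fin (legDim a b c s)} (hij : i < j) :
    ∃ lam ∈ cone (legDim a b c), pairing (tup (fun i => HA i + z) HB HC) lam = 0 ∧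
      lam s j < lam s i := by
  by_contra! hcon
  obtain ⟨htr, hne, hpos, hrank⟩ := hfacet
  obtain ⟨rfl, r, hr⟩ := eq_smul_of_face_subset_wall ha hab hbc htr hrank s hij
    fun lam hlam h0 => by
      have hmem := (mem_kronCone_iff _ _ _).1 hlam
      exact le_antisymm (hcon _ hmem ((pairing_tup HA HB HC z lam).trans h0)) (hmem.1 s hij.le)
  rcases lt_trichotomy r 0 with hneg | rfl | hrpos
  · obtain ⟨lam, hlam, hlt⟩ := exists_mem_cone_legDim_lt hab hbc hcab ha s i j hij
    have h := pairing_tup_nonneg hpos hlam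
    simp only [add_zero] at h
    rw [hr, ← pairingMap_apply, map_smul, LinearMap.smul_apply, pairingMap_apply,
      pairing_single_sub_single, smul_eq_mul] at h
    nlinarith
  · rw [zero_smul] at hr
    exact hne ⟨congrFun hr 0, congrFun hr 1, congrFun hr 2, rfl⟩
  · exact hnt (isTrivialNormal_of_tup_eq hrpos s i j hij hr)

lemma exists_strictAnti_mem_face (ha : 1 < a) (hab : a ≤ b) (hbc : b ≤ c) (hcab : c ≤ a * b)
    {HA : Fin a → ℝ} {HB : Fin b → ℝ} {HC : Fin c → ℝ} {z : ℝ}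
    (hfacet : IsFacetNormal a b c HA HB HC z) (hnt : ¬ IsTrivialNormal HA HB HC z) :
    ∃ lam ∈ cone (legDim a b c), pairing (tup (fun i => HA i + z) HB HC) lam = 0 ∧
      ∀ s, StrictAnti (lam s) := by
  set H := tup (fun i => HA i + z) HB HC
  have hwall : ∀ s (i j : Fin (legDim a b c s)), i < j →
      ∃ lam ∈ {lam ∈ spectra (legDim a b c) | pairing H lam = 0}, lam s j < lam s i := by
    intro s i j hij
    obtain ⟨lam, hlam, h0, hlt⟩ :=
      exists_mem_face_lt (by omega) hab hbc hcab hfacet hnt s hij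
    obtain ⟨t, ht, hmem⟩ := exists_smul_mem_spectra hlam hlt
    refine ⟨t • lam, ⟨hmem, ?_⟩, mul_lt_mul_of_pos_left hlt ht⟩
    rw [pairing_smul, h0, mul_zero]
  obtain ⟨lam, ⟨hlam, h0⟩, hs⟩ := exists_strictAnti_of_midpoint
    {lam ∈ spectra (legDim a b c) | pairing H lam = 0}
    (by
      obtain ⟨lam, hlam, -⟩ := hwall 0 (⟨0, by omega⟩ : Fin a) (⟨1, ha⟩ : Fin a)
        (Fin.mk_lt_mk.2 one_pos)
      exact ⟨lam, hlam⟩)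
    (fun lam hlam => hlam.1.1)
    (by
      rintro lam ⟨hlam, h0⟩ mu ⟨hmu, h0'⟩
      refine ⟨midpoint_mem_spectra hlam hmu, ?_⟩
      have : (fun s i => (lam s i + mu s i) / 2) = (2⁻¹ : ℝ) • (lam + mu) := by
        funext s i
        simp only [Pi.smul_apply, Pi.add_apply, smul_eq_mul]
        ring
      rw [this, ← pairingMap_apply, map_smul, map_add, pairingMap_apply, pairingMap_apply, h0,
        h0', add_zero, smul_zero])
    hwall
  exact ⟨lam, mem_cone_of_mem_spectra hlam, h0, hs⟩

end

end Multipartite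

/-- the trace condition for non-trivial facets. -/
theorem trace_condition_of_facet (a b c : ℕ)
    (ha : 1 < a) (hab : a ≤ b) (hbc : b ≤ c) (hcab : c ≤ a * b)
    (HA : Fin a → ℝ) (HB : Fin b → ℝ) (HC : Fin c → ℝ) (z : ℝ)
    (hfacet : IsFacetNormal a b c HA HB HC z)
    (hnt : ¬ IsTrivialNormal HA HB HC z) :
    Nat.card { p : Fin a × Fin b × Fin c // HA p.1 + HB p.2.1 + HC p.2.2 + z < 0 }
      = Nat.card { q : Fin a × Fin a // q.1 < q.2 ∧ HA q.2 < HA q.1 }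
        + Nat.card { q : Fin b × Fin b // q.1 < q.2 ∧ HB q.2 < HB q.1 }
        + Nat.card { q : Fin c × Fin c // q.1 < q.2 ∧ HC q.2 < HC q.1 } := by
  obtain ⟨lam, hlam, h0, hs⟩ :=
    Multipartite.exists_strictAnti_mem_face ha hab hbc hcab hfacet hnt
  have h := Multipartite.card_neg_eq_card_inversions
    (fun mu hmu => Multipartite.pairing_tup_nonneg hfacet.2.2.1 hmu) hs h0 hlam
  rw [Fin.sum_univ_three] at h
  refine Eq.trans (Nat.card_congr ((Multipartite.tripleEquiv a b c).subtypeEquiv fun p => ?_))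
    (h.trans ?_)
  · rw [Multipartite.weight_tup]
  · change Nat.card { q : Fin a × Fin a // q.1 < q.2 ∧ HA q.2 + z < HA q.1 + z } + _ + _ = _
    simp only [add_lt_add_iff_right]
    rfl

end
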